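/- Let d ≥ 1 be an integer and let A ⊆ [0,d] be a nonempty analytic set that contains its infimum and its supremum. Then there exists a compact set K ⊆ ℝ^d such that {dim_H E : E is a microset of K} = A. -/

import Mathlib

open Filter MeasureTheory Set
open scoped ENNReal
/-- `E` is a microset of the compact set `K ⊆ ℝ^d`: `E` is a compact subset of the unit
cube `[0,1]^d` intersecting the open cube `(0,1)^d`, and there are reals `λ n ≥ 1` and
vectors `u n` such that `(λ n • K + u n) ∩ [0,1]^d` converges to `E` in the Hausdorff
metric. -/
def IsMicroset (d : ℕ) (K E : Set (Fin d → ℝ)) : Prop :=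
  IsCompact E ∧ E ⊆ Set.univ.pi (fun _ => Set.Icc (0 : ℝ) 1) ∧
  (E ∩ Set.univ.pi (fun _ => Set.Ioo (0 : ℝ) 1)).Nonempty ∧
  ∃ (lam : ℕ → ℝ) (u : ℕ → Fin d → ℝ), (∀ n, 1 ≤ lam n) ∧
    Filter.Tendsto
      (fun n => EMetric.hausdorffEdist
        (((fun z => lam n • z + u n) '' K) ∩ Set.univ.pi (fun _ => Set.Icc (0 : ℝ) 1)) E)
      Filter.atTop (nhds 0)

namespace MS

noncomputable def P (x : ℕ → ℝ) (n : ℕ) : ℝ := ∑ k ∈ Finset.range n, x k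

def S (y : ℕ → Fin 2) (n : ℕ) : ℕ := ∑ k ∈ Finset.range n, (y k : ℕ)

lemma P_add (x : ℕ → ℝ) (n m : ℕ) : P x (n + m) = P x n + ∑ k ∈ Finset.range m, x (n + k) := by
  simp only [P, Finset.sum_range_add]

lemma P_mono {x : ℕ → ℝ} (hx : ∀ i, x i ∈ Icc (0:ℝ) 1) (n m : ℕ) :
    P x n ≤ P x (n + m) ∧ P x (n + m) ≤ P x n + m := by
  rw [P_add]
  constructor
  · have := Finset.sum_nonneg (s := Finset.range m) (f := fun k => x (n+k)) (fun i _ => (hx (n+i)).1)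
    linarith
  · have := Finset.sum_le_sum (s := Finset.range m) (f := fun k => x (n+k)) (g := fun _ => (1:ℝ))
      (fun i _ => (hx (n+i)).2)
    simp at this
    linarith

lemma P_lip {x : ℕ → ℝ} (hx : ∀ i, x i ∈ Icc (0:ℝ) 1) {a b c : ℕ} (h1 : a ≤ b + c) (h2 : b ≤ a + c) :
    |P x a - P x b| ≤ c := by
  rcases le_total a b with h | h
  · obtain ⟨e, rfl⟩ := Nat.exists_eq_add_of_le h
    have := P_mono hx a e
    have he : (e:ℝ) ≤ c := by exact_mod_cast (by omega : e ≤ c)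
    rw [abs_le]; constructor <;> linarith
  · obtain ⟨e, rfl⟩ := Nat.exists_eq_add_of_le h
    have := P_mono hx b e
    have he : (e:ℝ) ≤ c := by exact_mod_cast (by omega : e ≤ c)
    rw [abs_le]; constructor <;> linarith

noncomputable def clampX (D : ℝ) (i : ℕ) : ℝ := max 0 (min 1 (D - i))

lemma clampX_mem (D : ℝ) (i : ℕ) : clampX D i ∈ Icc (0:ℝ) 1 := by
  unfold clampX
  exact ⟨le_max_left _ _, max_le zero_le_one (min_le_left _ _)⟩

lemma sum_clamp (D : ℝ) (M : ℕ) : ∑ i ∈ Finset.range M, clampX D i = max 0 (min D M) := by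
  induction M with
  | zero => simp
  | succ M ih =>
    rw [Finset.sum_range_succ, ih, clampX]
    push_cast
    have hM : (0:ℝ) ≤ M := Nat.cast_nonneg M
    rcases le_total D 0 with h | h
    · rw [min_eq_left (by linarith), max_eq_left h, min_eq_right (by linarith),
        max_eq_left (by linarith), min_eq_left (by linarith), max_eq_left h]; simp
    rcases le_total D M with h' | h'
    · rw [min_eq_left h', max_eq_right h, min_eq_right (by linarith), max_eq_left (by linarith),
        min_eq_left (by linarith), max_eq_right h]; simp
    rcases le_total D (M+1) with h'' | h''
    · rw [min_eq_right h', max_eq_right hM, min_eq_right (by linarith), max_eq_right (by linarith),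
        min_eq_left h'', max_eq_right h]; ring
    · rw [min_eq_right h', max_eq_right hM, min_eq_left (by linarith), max_eq_right (by linarith),
        min_eq_right h'', max_eq_right (by linarith)]

noncomputable def XQ (q : ℕ → ℝ) (o : ℕ) : ℝ :=
  clampX ((2 * (Nat.sqrt o : ℝ) + 1) * q (Nat.sqrt o)) (o - (Nat.sqrt o) ^ 2)

lemma XQ_mem (q : ℕ → ℝ) (o : ℕ) : XQ q o ∈ Icc (0:ℝ) 1 := clampX_mem _ _

lemma XQ_block (q : ℕ → ℝ) (k i : ℕ) (h : i ≤ 2 * k) :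
    XQ q (k ^ 2 + i) = clampX ((2 * (k : ℝ) + 1) * q k) i := by
  unfold XQ
  rw [Nat.sqrt_add_eq' k (by omega)]
  simp

lemma XQ_congr {q q' : ℕ → ℝ} {o : ℕ} (h : q (Nat.sqrt o) = q' (Nat.sqrt o)) : XQ q o = XQ q' o := by
  unfold XQ; rw [h]

lemma P_XQ_sq {q : ℕ → ℝ} (hq : ∀ k, q k ∈ Icc (0:ℝ) 1) (k : ℕ) :
    P (XQ q) (k ^ 2) = P (fun o => q (Nat.sqrt o)) (k ^ 2) := by
  induction k with
  | zero => simp [P]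
  | succ k ih =>
    have e : (k + 1) ^ 2 = k ^ 2 + (2 * k + 1) := by ring
    rw [e, P_add, P_add, ih]
    congr 1
    have h1 : ∑ i ∈ Finset.range (2*k+1), XQ q (k^2+i)
        = ∑ i ∈ Finset.range (2*k+1), clampX ((2 * (k : ℝ) + 1) * q k) i :=
      Finset.sum_congr rfl (fun i hi => XQ_block q k i (by simp at hi; omega))
    have h2 : ∑ i ∈ Finset.range (2*k+1), q (Nat.sqrt (k^2+i))
        = ∑ i ∈ Finset.range (2*k+1), q k :=
      Finset.sum_congr rfl (fun i hi => by rw [Nat.sqrt_add_eq' k (by simp at hi; omega)])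
    rw [h1, h2, sum_clamp]
    have hk : (0:ℝ) ≤ 2 * k + 1 := by positivity
    have := hq k
    rw [min_eq_left, max_eq_right]
    · simp
    · exact mul_nonneg hk this.1
    · push_cast
      nlinarith [this.2]

lemma sqrt_le_aux (M : ℕ) : (Nat.sqrt M : ℝ) ≤ Real.sqrt M := Real.nat_sqrt_le_real_sqrt

lemma tendsto_const_div_nat (C : ℝ) : Tendsto (fun M : ℕ => C / (M : ℝ)) atTop (nhds 0) :=
  tendsto_const_div_atTop_nhds_zero_nat C

lemma tendsto_sqrt_atTop_nat : Tendsto Nat.sqrt atTop atTop := by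
  rw [tendsto_atTop]
  intro b
  filter_upwards [eventually_ge_atTop (b*b)] with a ha
  exact Nat.le_sqrt.2 ha

lemma XQ_avg {q : ℕ → ℝ} (hq : ∀ k, q k ∈ Icc (0:ℝ) 1) {b : ℝ} (hb : Tendsto q atTop (nhds b)) :
    Tendsto (fun M : ℕ => P (XQ q) M / M) atTop (nhds b) := by
  have h1 : Tendsto (fun o => q (Nat.sqrt o)) atTop (nhds b) := hb.comp tendsto_sqrt_atTop_nat
  have h2 := h1.cesaro
  have h3 : Tendsto (fun M : ℕ => P (XQ q) M / M - (M:ℝ)⁻¹ * ∑ i ∈ Finset.range M, q (Nat.sqrt i))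
      atTop (nhds 0) := by
    have h4 : Tendsto (fun M : ℕ => 4 * (Real.sqrt M)⁻¹) atTop (nhds 0) := by
      have : Tendsto (fun M : ℕ => Real.sqrt (M:ℝ)) atTop atTop :=
        Real.tendsto_sqrt_atTop.comp tendsto_natCast_atTop_atTop
      simpa using (tendsto_inv_atTop_zero.comp this).const_mul 4
    refine squeeze_zero_norm' ?_ h4
    filter_upwards [eventually_gt_atTop 0] with M hM
    have hM' : (0:ℝ) < M := by exact_mod_cast hM
    set k := Nat.sqrt M with hk
    have hk1 : k ^ 2 ≤ M := Nat.sqrt_le' M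
    have hk2 : M ≤ k ^ 2 + 2 * k := by
      have := Nat.sqrt_le_add M
      rw [← hk] at this; rw [sq]; omega
    have a1 := P_lip (XQ_mem q) (a := M) (b := k^2) (c := 2*k) hk2 (by omega)
    have a2 := P_lip (x := fun o => q (Nat.sqrt o)) (fun i => hq _) (a := M) (b := k^2) (c := 2*k) hk2 (by omega)
    rw [P_XQ_sq hq] at a1
    have a3 : |P (XQ q) M - P (fun o => q (Nat.sqrt o)) M| ≤ 4 * k := by
      rw [abs_le] at *
      push_cast at *
      constructor <;> linarith [a1.1, a1.2, a2.1, a2.2]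
    have e : P (XQ q) M / M - (M:ℝ)⁻¹ * ∑ i ∈ Finset.range M, q (Nat.sqrt i)
        = (P (XQ q) M - P (fun o => q (Nat.sqrt o)) M) / M := by
      simp only [P]; field_simp
    rw [e, Real.norm_eq_abs, abs_div, abs_of_pos hM', div_le_iff₀ hM']
    have hs : 0 < Real.sqrt M := Real.sqrt_pos.2 hM'
    have : 4 * (Real.sqrt M)⁻¹ * M = 4 * Real.sqrt M := by
      have := Real.mul_self_sqrt hM'.le
      field_simp
      nlinarith
    rw [this]
    have := sqrt_le_aux M
    linarith
  have := h3.add h2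
  simpa using this

noncomputable def xs (Q : ℕ → ℕ → ℝ) (p : ℕ) : ℝ := XQ (Q (Nat.log 2 p)) (p - 2 ^ (Nat.log 2 p))

lemma xs_mem (Q : ℕ → ℕ → ℝ) (p : ℕ) : xs Q p ∈ Icc (0:ℝ) 1 := XQ_mem _ _

lemma xs_eq (Q : ℕ → ℕ → ℝ) {m o : ℕ} (h : o < 2 ^ m) : xs Q (2 ^ m + o) = XQ (Q m) o := by
  unfold xs
  have : Nat.log 2 (2 ^ m + o) = m := by
    rw [Nat.log_eq_iff (by right; constructor <;> [norm_num; positivity])]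
    constructor
    · omega
    · rw [pow_succ]; omega
  rw [this]; simp

lemma P_le_of_zero {x : ℕ → ℝ} (hx : ∀ i, x i ∈ Icc (0:ℝ) 1) {K : ℕ} (h : ∀ i, K ≤ i → x i = 0) (N : ℕ) :
    P x N ≤ K := by
  rcases le_total N K with h' | h'
  · have := (P_mono hx 0 N).2
    simp [P] at this
    have h2 : (N:ℝ) ≤ K := by exact_mod_cast h'
    unfold P; linarith
  · obtain ⟨e, rfl⟩ := Nat.exists_eq_add_of_le h'
    rw [P_add, Finset.sum_eq_zero (fun i _ => h _ (by omega))]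
    have := (P_mono hx 0 K).2
    simp [P] at this
    unfold P; linarith

lemma P_xs_pow {Q : ℕ → ℕ → ℝ} (hz : ∀ m k, m < k → Q m k = 0) (m : ℕ) :
    P (xs Q) (2 ^ m) ≤ (m + 1) ^ 3 := by
  induction m with
  | zero =>
    have := (P_mono (xs_mem Q) 0 1).2
    simp [P] at this ⊢
    exact this
  | succ m ih =>
    rw [pow_succ, mul_two, P_add]
    have h1 : ∑ k ∈ Finset.range (2 ^ m), xs Q (2 ^ m + k) = P (XQ (Q m)) (2 ^ m) := by
      unfold P
      exact Finset.sum_congr rfl (fun i hi => xs_eq Q (by simpa using hi))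
    have h2 : P (XQ (Q m)) (2 ^ m) ≤ ((m + 1) ^ 2 : ℕ) := by
      apply P_le_of_zero (XQ_mem _)
      intro i hi
      have : m < Nat.sqrt i := by
        have := Nat.le_sqrt'.2 hi
        omega
      unfold XQ clampX
      rw [hz _ _ this]
      simp
    rw [h1]
    push_cast at *
    have hm : (0:ℝ) ≤ m := Nat.cast_nonneg m
    nlinarith [mul_nonneg hm hm]

lemma xs_avg {Q : ℕ → ℕ → ℝ} (hz : ∀ m k, m < k → Q m k = 0) :
    Tendsto (fun M : ℕ => P (xs Q) M / M) atTop (nhds 0) := by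
  have hl : Tendsto (fun M : ℕ => Nat.log 2 M) atTop atTop := by
    rw [tendsto_atTop]
    intro b
    filter_upwards [eventually_ge_atTop (2^b)] with a ha
    have h0 : 0 < 2 ^ b := by positivity
    exact (Nat.le_log_iff_pow_le (by norm_num) (by omega)).2 ha
  have h1 : Tendsto (fun m : ℕ => ((m:ℝ) + 2) ^ 3 / 2 ^ m) atTop (nhds 0) := by
    have := tendsto_pow_const_div_const_pow_of_one_lt 3 (show (1:ℝ) < 2 by norm_num)
    have := ((tendsto_add_atTop_iff_nat 2).2 this).const_mul 4
    simp only [mul_zero] at this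
    refine this.congr (fun m => ?_)
    push_cast
    rw [pow_add]; field_simp; norm_num
  refine squeeze_zero' ?_ ?_ (h1.comp hl)
  · filter_upwards with M
    exact div_nonneg (Finset.sum_nonneg (fun i _ => (xs_mem Q i).1)) (Nat.cast_nonneg _)
  · filter_upwards [eventually_gt_atTop 0] with M hM
    simp only [Function.comp]
    set m := Nat.log 2 M
    have b1 : 2 ^ m ≤ M := Nat.pow_log_le_self 2 (by omega)
    have b2 : M < 2 ^ (m+1) := Nat.lt_pow_succ_log_self (by norm_num) M
    have b3 : P (xs Q) M ≤ ((m:ℝ)+2)^3 := by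
      have := P_xs_pow hz (m+1)
      obtain ⟨e, he⟩ := Nat.exists_eq_add_of_le b2.le
      have h := (P_mono (xs_mem Q) M e).1
      rw [← he] at h
      push_cast at this
      calc _ ≤ _ := h
        _ ≤ _ := this
        _ = _ := by ring
    have b4 : (2:ℝ)^m ≤ M := by exact_mod_cast b1
    gcongr

end MS

namespace MS

lemma uf_dich (𝒰 : Ultrafilter ℕ) (a : ℕ → ℕ) :
    (∃ c, ∀ᶠ j in (𝒰 : Filter ℕ), a j = c) ∨ (∀ M, ∀ᶠ j in (𝒰 : Filter ℕ), M ≤ a j) := by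
  by_cases h : ∃ M, ∀ᶠ j in (𝒰 : Filter ℕ), a j < M
  · left
    obtain ⟨M, hM⟩ := h
    induction M with
    | zero => exact absurd hM (by simp [𝒰.neBot.ne])
    | succ M ih =>
      by_cases h' : ∀ᶠ j in (𝒰 : Filter ℕ), a j = M
      · exact ⟨M, h'⟩
      · rw [← Ultrafilter.eventually_not] at h'
        apply ih
        filter_upwards [hM, h'] with j h1 h2
        omega
  · right
    push Not at h
    intro M
    exact h M

noncomputable def Rf (α β : ℝ) (x : ℕ → ℝ) (n : ℕ) : ℝ := α * n + (β - α) * P x n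

noncomputable def yf (α β : ℝ) (x : ℕ → ℝ) (n : ℕ) : Fin 2 :=
  if ⌊Rf α β x (n+1)⌋ = ⌊Rf α β x n⌋ then 0 else 1

lemma S_succ (y : ℕ → Fin 2) (n : ℕ) : S y (n+1) = S y n + (y n : ℕ) := Finset.sum_range_succ _ _

lemma S_add (y : ℕ → Fin 2) (n m : ℕ) : S y (n + m) = S y n + S (fun k => y (n + k)) m := by
  simp only [S, Finset.sum_range_add]

lemma S_congr {y z : ℕ → Fin 2} {n : ℕ} (h : ∀ k < n, y k = z k) : S y n = S z n :=
  Finset.sum_congr rfl (fun k hk => by rw [h k (by simpa using hk)])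

lemma S_yf {α β : ℝ} (h0 : 0 ≤ α) (h1 : α ≤ β) (h2 : β ≤ 1) {x : ℕ → ℝ} (hx : ∀ i, x i ∈ Icc (0:ℝ) 1)
    (n : ℕ) : (S (yf α β x) n : ℤ) = ⌊Rf α β x n⌋ := by
  induction n with
  | zero => simp [S, Rf, P]
  | succ n ih =>
    rw [S_succ]
    push_cast
    rw [ih]
    have e : Rf α β x (n+1) = Rf α β x n + (α + (β - α) * x n) := by
      simp only [Rf, P, Finset.sum_range_succ]; push_cast; ring
    have l1 : Rf α β x n ≤ Rf α β x (n+1) := by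
      rw [e]; nlinarith [(hx n).1]
    have l2 : Rf α β x (n+1) ≤ Rf α β x n + 1 := by
      rw [e]; nlinarith [(hx n).2]
    have f1 := Int.floor_mono l1
    have f2 : ⌊Rf α β x (n+1)⌋ ≤ ⌊Rf α β x n⌋ + 1 := by
      have := Int.floor_mono l2
      simpa using this
    unfold yf
    split_ifs with h
    · simp [h]
    · simp; omega

/-- transfer lemma -/
lemma Tlem {α β : ℝ} (h0 : 0 ≤ α) (h1 : α ≤ β) (h2 : β ≤ 1) {x : ℕ → ℝ} (hx : ∀ i, x i ∈ Icc (0:ℝ) 1)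
    (𝒰 : Ultrafilter ℕ) (n : ℕ → ℕ) (z : ℕ → Fin 2)
    (hz : ∀ k, ∀ᶠ j in (𝒰 : Filter ℕ), yf α β x (n j + k) = z k)
    (W : ℕ → ℝ) (C : ℝ)
    (hW : ∀ M, ∀ᶠ j in (𝒰 : Filter ℕ), |P x (n j + M) - P x (n j) - W M| ≤ C) {b : ℝ}
    (hb : Tendsto (fun M : ℕ => W M / M) atTop (nhds b)) :
    Tendsto (fun M : ℕ => (S z M : ℝ) / M) atTop (nhds (α + (β - α) * b)) := by
  have key : ∀ M : ℕ, |(S z M : ℝ) - (α * M + (β - α) * W M)| ≤ 1 + (β - α) * C := by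
    intro M
    have ev : ∀ᶠ j in (𝒰 : Filter ℕ), ∀ k < M, yf α β x (n j + k) = z k := by
      have := (Set.finite_lt_nat M).eventually_all (l := (𝒰 : Filter ℕ)) (p := fun k j => yf α β x (n j + k) = z k)
      exact this.2 (fun k _ => hz k)
    obtain ⟨j, hj1, hj2⟩ := (ev.and (hW M)).exists
    have e1 : S z M = S (fun k => yf α β x (n j + k)) M := (S_congr hj1).symm
    have e2 := S_add (yf α β x) (n j) M
    rw [← e1] at e2
    have e3 := S_yf h0 h1 h2 hx (n j + M)
    have e4 := S_yf h0 h1 h2 hx (n j)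
    have e5 : (S z M : ℝ) = (⌊Rf α β x (n j + M)⌋ : ℝ) - ⌊Rf α β x (n j)⌋ := by
      rw [← e3, ← e4, e2]; push_cast; ring
    have a1 := Int.floor_le (Rf α β x (n j + M))
    have a2 := Int.lt_floor_add_one (Rf α β x (n j + M))
    have a3 := Int.floor_le (Rf α β x (n j))
    have a4 := Int.lt_floor_add_one (Rf α β x (n j))
    have e6 : Rf α β x (n j + M) - Rf α β x (n j) - (α * M + (β - α) * W M)
        = (β - α) * (P x (n j + M) - P x (n j) - W M) := by
      simp only [Rf]; push_cast; ring
    have e7 : |(β - α) * (P x (n j + M) - P x (n j) - W M)| ≤ (β - α) * C := by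
      rw [abs_mul, abs_of_nonneg (sub_nonneg.2 h1)]
      exact mul_le_mul_of_nonneg_left hj2 (sub_nonneg.2 h1)
    rw [e5]
    rw [← e6] at e7
    rw [abs_le] at *
    constructor <;> linarith [e7.1, e7.2]
  have t1 : Tendsto (fun M : ℕ => α + (β - α) * (W M / M)) atTop (nhds (α + (β - α) * b)) :=
    (hb.const_mul _).const_add _
  have t2 : Tendsto (fun M : ℕ => (S z M : ℝ) / M - (α + (β - α) * (W M / M))) atTop (nhds 0) := by
    refine squeeze_zero_norm' ?_ (tendsto_const_div_nat (1 + (β - α) * C))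
    filter_upwards [eventually_gt_atTop 0] with M hM
    have hM' : (0:ℝ) < M := by exact_mod_cast hM
    have e : (S z M : ℝ) / M - (α + (β - α) * (W M / M))
        = ((S z M : ℝ) - (α * M + (β - α) * W M)) / M := by
      field_simp
      try ring
    rw [e, Real.norm_eq_abs, abs_div, abs_of_pos hM']
    have := key M
    gcongr
  have := t2.add t1
  simpa using this

def g (k : ℕ) (c : ℕ → ℕ) (i : ℕ) : ℕ := if i ≤ k ∧ c i ≤ k then c i else 0

lemma g_tendsto (c : ℕ → ℕ) : Tendsto (fun k => g k c) atTop (nhds c) := by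
  rw [tendsto_pi_nhds]
  intro i
  refine tendsto_const_nhds.congr' ?_
  filter_upwards [eventually_ge_atTop i, eventually_ge_atTop (c i)] with k h1 h2
  simp [g, h1, h2]

lemma g_congr {k : ℕ} {c c' : ℕ → ℕ} (h : ∀ i ≤ k, g k c i = g k c' i) : g k c = g k c' := by
  funext i
  by_cases hi : i ≤ k
  · exact h i hi
  · simp [g, hi]

lemma g_limit (𝒰 : Ultrafilter ℕ) (ν : ℕ → ℕ → ℕ) :
    ∃ c : ℕ → ℕ, ∀ k, ∀ᶠ j in (𝒰 : Filter ℕ), g k (ν j) = g k c := by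
  have : ∀ i, ∃ ci : ℕ, ∀ k, ∀ᶠ j in (𝒰 : Filter ℕ), (if ν j i ≤ k then ν j i else 0) = if ci ≤ k then ci else 0 := by
    intro i
    rcases uf_dich 𝒰 (fun j => ν j i) with ⟨c, hc⟩ | h
    · refine ⟨c, fun k => ?_⟩
      filter_upwards [hc] with j hj
      rw [hj]
    · refine ⟨0, fun k => ?_⟩
      filter_upwards [h (k+1)] with j hj
      rw [if_neg (by omega)]; simp
  choose c hc using this
  refine ⟨c, fun k => ?_⟩
  have := (Set.finite_le_nat k).eventually_all (l := (𝒰 : Filter ℕ))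
    (p := fun i j => (if ν j i ≤ k then ν j i else 0) = if c i ≤ k then c i else 0)
  filter_upwards [this.2 (fun i _ => hc i k)] with j hj
  apply g_congr
  intro i hi
  have := hj i hi
  simpa [g, hi] using this

def nu (m : ℕ) (i : ℕ) : ℕ := (Denumerable.ofNat (List ℕ) (Nat.unpair m).1).getD i 0

lemma nu_dense (c : ℕ → ℕ) (j : ℕ) : ∃ m, j ≤ m ∧ ∀ i ≤ j, nu m i = c i := by
  refine ⟨Nat.pair (Encodable.encode ((List.range (j+1)).map c)) j, Nat.right_le_pair _ _, ?_⟩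
  intro i hi
  have : i < j + 1 := by omega
  simp [nu, Nat.unpair_pair, List.getD_eq_getElem?_getD, this]

section
variable {f : (ℕ → ℕ) → ℝ}

noncomputable def Qf (f : (ℕ → ℕ) → ℝ) (m k : ℕ) : ℝ := if k ≤ m then f (g k (nu m)) else 0

lemma Qf_zero (m k : ℕ) (h : m < k) : Qf f m k = 0 := by
  unfold Qf; rw [if_neg (by omega)]

lemma window (𝒰 : Ultrafilter ℕ) (n m : ℕ → ℕ) (a c₀ : ℕ)
    (hm : ∀ M, ∀ᶠ j in (𝒰 : Filter ℕ), M ≤ m j)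
    (hn : ∀ᶠ j in (𝒰 : Filter ℕ), n j + a = 2 ^ (m j) + c₀)
    (c : ℕ → ℕ) (hc : ∀ k, ∀ᶠ j in (𝒰 : Filter ℕ), g k (nu (m j)) = g k c) (M : ℕ) :
    ∀ᶠ j in (𝒰 : Filter ℕ), |P (xs (Qf f)) (n j + M) - P (xs (Qf f)) (n j)
      - P (XQ (fun k => f (g k c))) M| ≤ 2 * (a + c₀ : ℕ) := by
  have h1 := ((Set.finite_lt_nat M).eventually_all (l := (𝒰 : Filter ℕ))
    (p := fun k j => g k (nu (m j)) = g k c)).2 (fun k _ => hc k)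
  filter_upwards [h1, hm M, hn] with j hj1 hj2 hj3
  have e : P (xs (Qf f)) (2 ^ (m j) + M) - P (xs (Qf f)) (2 ^ (m j)) = P (XQ (fun k => f (g k c))) M := by
    rw [P_add]
    simp only [P, add_sub_cancel_left]
    apply Finset.sum_congr rfl
    intro i hi
    simp only [Finset.mem_range] at hi
    have : m j < 2 ^ (m j) := Nat.lt_two_pow_self
    rw [xs_eq _ (by omega)]
    apply XQ_congr
    have hs : Nat.sqrt i ≤ i := Nat.sqrt_le_self i
    unfold Qf
    rw [if_pos (by omega), hj1 _ (by change _ < _; omega)]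
  have l1 := P_lip (xs_mem (Qf f)) (a := n j + M) (b := 2 ^ (m j) + M) (c := a + c₀) (by omega) (by omega)
  have l2 := P_lip (xs_mem (Qf f)) (a := n j) (b := 2 ^ (m j)) (c := a + c₀) (by omega) (by omega)
  rw [← e]
  rw [abs_le] at *
  constructor <;> linarith [l1.1, l1.2, l2.1, l2.2]

lemma clamp_case (𝒰 : Ultrafilter ℕ) (x : ℕ → ℝ) (hx : ∀ i, x i ∈ Icc (0:ℝ) 1)
    (n : ℕ → ℕ) (e : ℕ) (D : ℕ → ℝ)
    (hD : ∀ M, ∀ᶠ j in (𝒰 : Filter ℕ), ∀ i < M, x (n j + e + i) = clampX (D j) i)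
    (hex : (∃ c, f c = 0) ∧ (∃ c, f c = 1)) :
    ∃ c C, ∀ M : ℕ, ∀ᶠ j in (𝒰 : Filter ℕ), |P x (n j + M) - P x (n j) - f c * M| ≤ C := by
  have base : ∀ M, ∀ᶠ j in (𝒰 : Filter ℕ),
      |P x (n j + M) - P x (n j) - max 0 (min (D j) M)| ≤ 2 * e := by
    intro M
    filter_upwards [hD M] with j hj
    have e1 : P x (n j + e + M) - P x (n j + e) = max 0 (min (D j) M) := by
      rw [P_add, ← sum_clamp, add_sub_cancel_left]
      exact Finset.sum_congr rfl (fun i hi => hj i (by simpa using hi))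
    have l1 := P_lip hx (a := n j + M) (b := n j + e + M) (c := e) (by omega) (by omega)
    have l2 := P_lip hx (a := n j) (b := n j + e) (c := e) (by omega) (by omega)
    rw [← e1]
    rw [abs_le] at *
    constructor <;> linarith [l1.1, l1.2, l2.1, l2.2]
  obtain ⟨⟨c0, hc0⟩, ⟨c1, hc1⟩⟩ := hex
  by_cases h : ∃ A, ∀ᶠ j in (𝒰 : Filter ℕ), D j ≤ A
  · obtain ⟨A, hA⟩ := h
    refine ⟨c0, 2 * e + max 0 A, fun M => ?_⟩
    filter_upwards [base M, hA] with j h1 h2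
    rw [hc0]
    have h3 : max 0 (min (D j) M) ≤ max 0 A := max_le_max le_rfl ((min_le_left _ _).trans h2)
    have h4 : 0 ≤ max 0 (min (D j) M) := le_max_left _ _
    rw [abs_le] at *
    constructor <;> linarith [h1.1, h1.2]
  · push Not at h
    refine ⟨c1, 2 * e, fun M => ?_⟩
    have := h M
    filter_upwards [base M, this] with j h1 h2
    rw [hc1]
    rw [min_eq_right (by linarith), max_eq_right (Nat.cast_nonneg _)] at h1
    simpa using h1

lemma b2_case (𝒰 : Ultrafilter ℕ) (n m o : ℕ → ℕ)
    (hex : (∃ c, f c = 0) ∧ (∃ c, f c = 1))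
    (hn : ∀ᶠ j in (𝒰 : Filter ℕ), n j = 2 ^ (m j) + o j)
    (ho : ∀ M, ∀ᶠ j in (𝒰 : Filter ℕ), M ≤ o j)
    (hr : ∀ M, ∀ᶠ j in (𝒰 : Filter ℕ), M ≤ 2 ^ (m j + 1) - n j) :
    ∃ c C, ∀ M : ℕ, ∀ᶠ j in (𝒰 : Filter ℕ),
      |P (xs (Qf f)) (n j + M) - P (xs (Qf f)) (n j) - f c * M| ≤ C := by
  have hx : ∀ M, ∀ᶠ j in (𝒰 : Filter ℕ), ∀ i < M, xs (Qf f) (n j + i) = XQ (Qf f (m j)) (o j + i) := by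
    intro M
    filter_upwards [hn, hr M] with j h1 h2 i hi
    rw [h1, add_assoc, xs_eq]
    rw [pow_succ] at h2; omega
  have hk : ∀ M, ∀ᶠ j in (𝒰 : Filter ℕ), M ≤ Nat.sqrt (o j) := by
    intro M
    filter_upwards [ho (M*M)] with j hj
    exact Nat.le_sqrt.2 hj
  have hlt : ∀ j, o j < (Nat.sqrt (o j) + 1) ^ 2 := fun j => Nat.lt_succ_sqrt' _
  rcases uf_dich 𝒰 (fun j => (Nat.sqrt (o j) + 1) ^ 2 - o j) with ⟨e, he⟩ | he
  · refine clamp_case (f := f) 𝒰 _ (xs_mem _) n e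
      (fun j => (2 * ((Nat.sqrt (o j) + 1 : ℕ) : ℝ) + 1) * Qf f (m j) (Nat.sqrt (o j) + 1)) ?_ hex
    intro M
    filter_upwards [hx (e + M), he, hk M] with j h1 h2 h3 i hi
    rw [add_assoc, h1 (e + i) (by omega)]
    have : o j + (e + i) = (Nat.sqrt (o j) + 1) ^ 2 + i := by
      have := hlt j; omega
    rw [this, XQ_block _ _ _ (by omega)]
  · refine clamp_case (f := f) 𝒰 _ (xs_mem _) n 0
      (fun j => (2 * ((Nat.sqrt (o j) : ℕ) : ℝ) + 1) * Qf f (m j) (Nat.sqrt (o j))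
        - (o j - (Nat.sqrt (o j))^2 : ℕ)) ?_ hex
    intro M
    filter_upwards [hx M, he (M+1)] with j h1 h2 i hi
    rw [add_zero, h1 i hi]
    have hle : (Nat.sqrt (o j))^2 ≤ o j := Nat.sqrt_le' _
    have e1 : o j + i = (Nat.sqrt (o j)) ^ 2 + ((o j - (Nat.sqrt (o j))^2) + i) := by omega
    have e2 : (Nat.sqrt (o j) + 1) ^ 2 = (Nat.sqrt (o j))^2 + 2 * Nat.sqrt (o j) + 1 := by ring
    rw [e1, XQ_block _ _ _ (by omega)]
    unfold clampX
    push_cast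
    congr 2
    ring

theorem comb (hf : Continuous f) (h01 : ∀ c, f c ∈ Icc (0:ℝ) 1) (hex : (∃ c, f c = 0) ∧ (∃ c, f c = 1)) {α β : ℝ} (h0 : 0 ≤ α) (h1 : α ≤ β) (h2 : β ≤ 1) :
    ∃ y : ℕ → Fin 2,
      (∀ (𝒰 : Ultrafilter ℕ) (n : ℕ → ℕ) (z : ℕ → Fin 2),
        (∀ k, ∀ᶠ j in (𝒰 : Filter ℕ), y (n j + k) = z k) →
        ∃ c, Tendsto (fun M : ℕ => (S z M : ℝ) / M) atTop (nhds (α + (β - α) * f c))) ∧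
      (∀ c, ∃ n : ℕ → ℕ, ∀ φ : ℕ → ℕ, StrictMono φ → ∀ 𝒰 : Ultrafilter ℕ, (𝒰 : Filter ℕ) ≤ atTop →
        ∀ z : ℕ → Fin 2, (∀ k, ∀ᶠ j in (𝒰 : Filter ℕ), y (n (φ j) + k) = z k) →
        Tendsto (fun M : ℕ => (S z M : ℝ) / M) atTop (nhds (α + (β - α) * f c))) := by
  have hfg : ∀ c, Tendsto (fun k => f (g k c)) atTop (nhds (f c)) := fun c =>
    (hf.tendsto c).comp (g_tendsto c)
  have mainA : ∀ (𝒰 : Ultrafilter ℕ) (n m : ℕ → ℕ) (a c₀ : ℕ) (z : ℕ → Fin 2)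
      (_ : ∀ k, ∀ᶠ j in (𝒰 : Filter ℕ), yf α β (xs (Qf f)) (n j + k) = z k)
      (_ : ∀ M, ∀ᶠ j in (𝒰 : Filter ℕ), M ≤ m j)
      (_ : ∀ᶠ j in (𝒰 : Filter ℕ), n j + a = 2 ^ (m j) + c₀)
      (c : ℕ → ℕ) (_ : ∀ k, ∀ᶠ j in (𝒰 : Filter ℕ), g k (nu (m j)) = g k c),
      Tendsto (fun M : ℕ => (S z M : ℝ) / M) atTop (nhds (α + (β - α) * f c)) := by
    intro 𝒰 n m a c₀ z hz hm hn c hc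
    exact Tlem h0 h1 h2 (xs_mem _) 𝒰 n z hz _ _ (window 𝒰 n m a c₀ hm hn c hc)
      (XQ_avg (fun k => h01 _) (hfg c))
  refine ⟨yf α β (xs (Qf f)), ?_, ?_⟩
  · intro 𝒰 n z hz
    rcases uf_dich 𝒰 n with ⟨c, hc⟩ | hn
    · obtain ⟨c0, hc0⟩ := hex.1
      refine ⟨c0, Tlem h0 h1 h2 (xs_mem _) 𝒰 n z hz (P (xs (Qf f))) (2*c) ?_ ?_⟩
      · intro M
        filter_upwards [hc] with j hj
        rw [hj]
        have l1 := P_lip (xs_mem (Qf f)) (a := c + M) (b := M) (c := c) (by omega) (by omega)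
        have l2 := P_lip (xs_mem (Qf f)) (a := c) (b := 0) (c := c) (by omega) (by omega)
        have l3 : P (xs (Qf f)) 0 = 0 := by simp [P]
        rw [abs_le] at *
        constructor <;> linarith [l1.1, l1.2, l2.1, l2.2]
      · rw [hc0]; exact xs_avg Qf_zero
    · set m : ℕ → ℕ := fun j => Nat.log 2 (n j) with hmdef
      have hpos := hn 1
      have b1 : ∀ᶠ j in (𝒰 : Filter ℕ), 2 ^ (m j) ≤ n j := by
        filter_upwards [hpos] with j hj
        exact Nat.pow_log_le_self 2 (by omega)
      have b2 : ∀ j, n j < 2 ^ (m j + 1) := fun j => Nat.lt_pow_succ_log_self (by norm_num) _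
      have hm : ∀ M, ∀ᶠ j in (𝒰 : Filter ℕ), M ≤ m j := by
        intro M
        filter_upwards [hn (2 ^ M), hpos] with j hj hj'
        exact (Nat.le_log_iff_pow_le (by norm_num) (by omega)).2 hj
      rcases uf_dich 𝒰 (fun j => n j - 2 ^ (m j)) with ⟨o, ho⟩ | ho
      · obtain ⟨c, hc⟩ := g_limit 𝒰 (fun j => nu (m j))
        refine ⟨c, mainA 𝒰 n m 0 o z hz hm ?_ c hc⟩
        filter_upwards [ho, b1] with j h3 h4
        omega
      rcases uf_dich 𝒰 (fun j => 2 ^ (m j + 1) - n j) with ⟨r, hr⟩ | hr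
      · obtain ⟨c, hc⟩ := g_limit 𝒰 (fun j => nu (m j + 1))
        refine ⟨c, mainA 𝒰 n (fun j => m j + 1) r 0 z hz ?_ ?_ c hc⟩
        · intro M
          filter_upwards [hm M] with j hj
          omega
        · filter_upwards [hr] with j h3
          have := b2 j
          omega
      · obtain ⟨c, C, hC⟩ := b2_case (f := f) 𝒰 n m (fun j => n j - 2 ^ (m j)) hex
          (by filter_upwards [b1] with j hj; omega) ho hr
        refine ⟨c, Tlem h0 h1 h2 (xs_mem _) 𝒰 n z hz (fun M => f c * M) C hC ?_⟩
        refine tendsto_const_nhds.congr' ?_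
        filter_upwards [eventually_gt_atTop 0] with M hM
        have hM' : (M:ℝ) ≠ 0 := by exact_mod_cast hM.ne'
        field_simp
  · intro c
    choose m hm1 hm2 using nu_dense c
    refine ⟨fun j => 2 ^ (m j), fun φ hφ 𝒰 h𝒰 z hz => ?_⟩
    have hev : ∀ M, ∀ᶠ j in (𝒰 : Filter ℕ), M ≤ φ j := fun M =>
      h𝒰 (hφ.tendsto_atTop.eventually_ge_atTop M)
    refine mainA 𝒰 (fun j => 2 ^ (m (φ j))) (fun j => m (φ j)) 0 0 z hz ?_ (by simp) c ?_
    · intro M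
      filter_upwards [hev M] with j hj
      exact hj.trans (hm1 _)
    · intro k
      filter_upwards [hev k] with j hj
      apply g_congr
      intro i hi
      simp only [g]
      rw [hm2 _ _ (hi.trans hj)]
end

end MS

namespace MS

noncomputable def B (w : ℕ → Fin 2) : ℝ := Real.ofDigits w

def Xi (w : ℕ → Fin 2) : ℕ → ℕ
  | 0 => 0
  | n + 1 => 2 * Xi w n + (w n : ℕ)

lemma B_nonneg (w) : 0 ≤ B w := Real.ofDigits_nonneg w
lemma B_le_one (w) : B w ≤ 1 := Real.ofDigits_le_one w
lemma B_cont : Continuous B := Real.continuous_ofDigits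

lemma B_split (w : ℕ → Fin 2) (n : ℕ) : (2:ℝ) ^ n * B w = Xi w n + B (fun i => w (n + i)) := by
  have h := Real.ofDigits_eq_sum_add_ofDigits w n
  have h2 : (2:ℝ) ^ n * ∑ i ∈ Finset.range n, Real.ofDigitsTerm w i = Xi w n := by
    clear h
    induction n with
    | zero => simp [Xi]
    | succ n ih =>
      rw [Finset.sum_range_succ, mul_add, pow_succ, mul_assoc, mul_comm (2:ℝ) (∑ i ∈ Finset.range n, Real.ofDigitsTerm w i),
        ← mul_assoc, ih, Xi, Real.ofDigitsTerm]
      push_cast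
      field_simp
      ring
  unfold B
  rw [h, mul_add, h2]
  have : ((2:ℕ):ℝ) = 2 := by norm_num
  rw [this, ← mul_assoc, mul_inv_cancel₀ (by positivity), one_mul]
  simp only [add_comm]

lemma B_agree {x y : ℕ → Fin 2} {n : ℕ} (hxy : ∀ i < n, x i = y i) : |B x - B y| ≤ ((2 : ℝ) ^ n)⁻¹ := by
  have := Real.abs_ofDigits_sub_ofDigits_le hxy
  simpa [B] using this

def Wd (d : ℕ) (z : ℕ → Fin 2) : Set (Fin d → ℕ → Fin 2) := {w | ∀ i k, z k = 0 → w i k = 0}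

noncomputable def Ez (d : ℕ) (z : ℕ → Fin 2) : Set (Fin d → ℝ) := (fun w i => B (w i)) '' Wd d z

lemma card_ones (z : ℕ → Fin 2) (n : ℕ) : Fintype.card {k : Fin n // z k = 1} = S z n := by
  rw [Fintype.card_subtype, Finset.card_filter, S, Fin.sum_univ_eq_sum_range (fun k => if z k = 1 then 1 else 0) n]
  apply Finset.sum_congr rfl
  intro k _
  generalize z k = a
  fin_cases a <;> simp

lemma dim_upper (d : ℕ) (z : ℕ → Fin 2) {s : ℝ}
    (hs : Tendsto (fun M : ℕ => (S z M : ℝ) / M) atTop (nhds s)) :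
    dimH (Ez d z) ≤ ENNReal.ofReal (d * s) := by
  by_contra hcon
  push Not at hcon
  obtain ⟨r, hr1, hr2⟩ := ENNReal.lt_iff_exists_nnreal_btwn.1 hcon
  have hr : d * s < r := by
    have hs0 : 0 ≤ s := ge_of_tendsto' hs (fun M => by positivity)
    have := (ENNReal.ofReal_lt_coe_iff (by positivity)).1 hr1
    exact this
  have hle : μH[r] (Ez d z) ≤ 1 := by
    let t : ∀ n : ℕ, (Fin d × {k : Fin n // z k = 1} → Fin 2) → Set (Fin d → ℝ) := fun n φ =>
      (fun w i => B (w i)) '' {w | w ∈ Wd d z ∧ ∀ i (k : {k : Fin n // z k = 1}), w i k.1 = φ (i, k)}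
    have hd : ∀ n φ, Metric.ediam (t n φ) ≤ ENNReal.ofReal (((2:ℝ)^n)⁻¹) := by
      intro n φ
      apply Metric.ediam_le
      rintro _ ⟨w, ⟨hw1, hw2⟩, rfl⟩ _ ⟨w', ⟨hw1', hw2'⟩, rfl⟩
      rw [edist_dist]
      apply ENNReal.ofReal_le_ofReal
      rw [dist_pi_le_iff (by positivity)]
      intro i
      rw [Real.dist_eq]
      apply B_agree
      intro k hk
      by_cases hz : z k = 0
      · rw [hw1 i k hz, hw1' i k hz]
      · have hz1 : z k = 1 := by
          revert hz; generalize z k = a; fin_cases a <;> simp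
        have a1 := hw2 i ⟨⟨k, hk⟩, hz1⟩
        have a2 := hw2' i ⟨⟨k, hk⟩, hz1⟩
        exact a1.trans a2.symm
    have h1 := Measure.hausdorffMeasure_le_liminf_sum (l := atTop) (r : ℝ) (Ez d z)
      (fun n : ℕ => ENNReal.ofReal (((2:ℝ)^n)⁻¹)) ?_ t (Eventually.of_forall hd) ?_
    · refine h1.trans ?_
      have h2 : ∀ᶠ n in atTop, ∑ φ, Metric.ediam (t n φ) ^ (r:ℝ) ≤ 1 := by
        have h3 : ∀ᶠ n : ℕ in atTop, d * ((S z n : ℝ) / n) < r :=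
          (hs.const_mul (d:ℝ)).eventually_lt_const hr
        filter_upwards [h3, eventually_gt_atTop 0] with n hn hn0
        have hn0' : (0:ℝ) < n := by exact_mod_cast hn0
        calc ∑ φ, Metric.ediam (t n φ) ^ (r:ℝ) ≤ ∑ φ : (Fin d × {k : Fin n // z k = 1} → Fin 2), (ENNReal.ofReal (((2:ℝ)^n)⁻¹)) ^ (r:ℝ) :=
              Finset.sum_le_sum (fun φ _ => ENNReal.rpow_le_rpow (hd n φ) r.2)
          _ = ENNReal.ofReal ((2:ℝ) ^ (d * S z n) * (((2:ℝ)^n)⁻¹) ^ (r:ℝ)) := by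
              rw [Finset.sum_const, Finset.card_univ, Fintype.card_fun, Fintype.card_prod, card_ones,
                Fintype.card_fin, Fintype.card_fin, ENNReal.ofReal_rpow_of_pos (by positivity),
                ENNReal.ofReal_mul (by positivity), ENNReal.ofReal_pow (by norm_num)]
              simp
          _ ≤ 1 := by
              rw [ENNReal.ofReal_le_one]
              rw [Real.inv_rpow (by positivity), ← div_eq_mul_inv, div_le_one (by positivity),
                ← Real.rpow_natCast, ← Real.rpow_natCast, ← Real.rpow_mul (by norm_num)]
              apply Real.rpow_le_rpow_of_exponent_le (by norm_num)
              push_cast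
              rw [← mul_div_assoc, div_lt_iff₀ hn0'] at hn
              nlinarith
      calc _ ≤ liminf (fun _ : ℕ => (1:ℝ≥0∞)) atTop := liminf_le_liminf h2
        _ = 1 := liminf_const 1
    · have : Tendsto (fun n : ℕ => ((2:ℝ)^n)⁻¹) atTop (nhds 0) := by
        have := tendsto_pow_atTop_nhds_zero_of_lt_one (r := (1/2:ℝ)) (by norm_num) (by norm_num)
        simpa using this
      simpa using ENNReal.tendsto_ofReal this
    · refine Eventually.of_forall fun n => ?_
      rintro _ ⟨w, hw, rfl⟩
      rw [mem_iUnion]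
      exact ⟨fun p => w p.1 p.2.1, w, ⟨hw, fun i k => rfl⟩, rfl⟩
  have := dimH_le_of_hausdorffMeasure_ne_top (hle.trans_lt ENNReal.one_lt_top).ne
  exact absurd hr2 (not_lt.2 this)

open Classical in
noncomputable def dig (z : ℕ → Fin 2) (t : ℝ) (k : ℕ) : Fin 2 :=
  if z k = 0 then 0 else if ⌊(2:ℝ)^(S z k + 1) * t⌋ = 2 * ⌊(2:ℝ)^(S z k) * t⌋ then 0 else 1

lemma floor_two (a : ℝ) : ⌊2 * a⌋ = 2 * ⌊a⌋ ∨ ⌊2 * a⌋ = 2 * ⌊a⌋ + 1 := by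
  have h1 := Int.floor_le a
  have h2 := Int.lt_floor_add_one a
  have h3 : 2 * ⌊a⌋ ≤ ⌊2 * a⌋ := by
    rw [Int.le_floor]; push_cast; linarith
  have h4 : ⌊2 * a⌋ < 2 * ⌊a⌋ + 2 := by
    rw [Int.floor_lt]; push_cast; linarith
  omega

lemma dig_step (z : ℕ → Fin 2) (t : ℝ) (n : ℕ) :
    ⌊(2:ℝ)^(S z (n+1)) * t⌋ = (1 + (z n : ℕ) : ℤ) * ⌊(2:ℝ)^(S z n) * t⌋ + (dig z t n : ℕ) := by
  rw [S_succ]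
  have h2 : z n = 0 ∨ z n = 1 := by
    generalize z n = a; fin_cases a <;> simp
  unfold dig
  rcases h2 with h | h
  · rw [h]; simp
  · rw [h]
    have e : (2:ℝ)^(S z n + 1) * t = 2 * ((2:ℝ)^(S z n) * t) := by rw [pow_succ]; ring
    have := floor_two ((2:ℝ)^(S z n) * t)
    rw [← e] at this
    rcases this with h' | h'
    · simp [h']
    · simp [h']

lemma dig_cmp (z : ℕ → Fin 2) (t t' : ℝ) (n : ℕ) :
    (0 ≤ ⌊(2:ℝ)^(S z n) * t⌋ - ⌊(2:ℝ)^(S z n) * t'⌋ + 0 →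
      t ∈ Ico (0:ℝ) 1 → t' ∈ Ico (0:ℝ) 1 →
      ⌊(2:ℝ)^(S z n) * t⌋ - ⌊(2:ℝ)^(S z n) * t'⌋ ≤ (Xi (dig z t) n : ℤ) - Xi (dig z t') n) ∧
    (⌊(2:ℝ)^(S z n) * t⌋ - ⌊(2:ℝ)^(S z n) * t'⌋ ≤ 0 →
      t ∈ Ico (0:ℝ) 1 → t' ∈ Ico (0:ℝ) 1 →
      (Xi (dig z t) n : ℤ) - Xi (dig z t') n ≤ ⌊(2:ℝ)^(S z n) * t⌋ - ⌊(2:ℝ)^(S z n) * t'⌋) := by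
  induction n with
  | zero =>
    have e : ∀ t ∈ Ico (0:ℝ) 1, ⌊(2:ℝ)^(S z 0) * t⌋ = 0 := by
      intro t ht
      simp [S, Int.floor_eq_zero_iff]
      exact ht
    constructor
    · intro _ h1 h2
      rw [e t h1, e t' h2]; simp [Xi]
    · intro _ h1 h2
      rw [e t h1, e t' h2]; simp [Xi]
  | succ n ih =>
    rw [dig_step, dig_step, Xi, Xi]
    have h2 : z n = 0 ∨ z n = 1 := by
      generalize z n = a; fin_cases a <;> simp
    have l1 : (dig z t n : ℕ) < 2 := (dig z t n).2
    have l2 : (dig z t' n : ℕ) < 2 := (dig z t' n).2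
    obtain ⟨i1, i2⟩ := ih
    rcases h2 with h | h
    · have d1 : dig z t n = 0 := by simp [dig, h]
      have d2 : dig z t' n = 0 := by simp [dig, h]
      rw [h, d1, d2]
      simp
      constructor
      · intro a b b' c c'
        have := i1 (by omega) ⟨b, b'⟩ ⟨c, c'⟩
        omega
      · intro a b b' c c'
        have := i2 (by omega) ⟨b, b'⟩ ⟨c, c'⟩
        omega
    · rw [h]
      push_cast
      generalize ⌊(2:ℝ)^(S z n) * t⌋ = a at *
      generalize ⌊(2:ℝ)^(S z n) * t'⌋ = b at *
      constructor
      · intro u v v'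
        rcases lt_trichotomy a b with q | q | q
        · simp at u; omega
        · have := i1 (by omega) v v'
          have := i2 (by omega) v v'
          simp; omega
        · have := i1 (by omega) v v'
          simp; omega
      · intro u v v'
        rcases lt_trichotomy a b with q | q | q
        · have := i2 (by omega) v v'
          simp; omega
        · have := i1 (by omega) v v'
          have := i2 (by omega) v v'
          simp; omega
        · simp at u; omega

lemma dig_ineq (z : ℕ → Fin 2) {t t' : ℝ} (ht : t ∈ Ico (0:ℝ) 1) (ht' : t' ∈ Ico (0:ℝ) 1) (n : ℕ) :
    |t - t'| * 2 ^ (S z n) ≤ 2 ^ n * |B (dig z t) - B (dig z t')| + 2 := by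
  obtain ⟨h1, h2⟩ := dig_cmp z t t' n
  have e1 := B_split (dig z t) n
  have e2 := B_split (dig z t') n
  have p1 := B_nonneg (fun i => dig z t (n + i))
  have p2 := B_le_one (fun i => dig z t (n + i))
  have p3 := B_nonneg (fun i => dig z t' (n + i))
  have p4 := B_le_one (fun i => dig z t' (n + i))
  have f1 := Int.floor_le ((2:ℝ)^(S z n) * t)
  have f2 := Int.lt_floor_add_one ((2:ℝ)^(S z n) * t)
  have f3 := Int.floor_le ((2:ℝ)^(S z n) * t')
  have f4 := Int.lt_floor_add_one ((2:ℝ)^(S z n) * t')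
  have g1 : |t - t'| * 2 ^ (S z n) = |(2:ℝ)^(S z n) * t - (2:ℝ)^(S z n) * t'| := by
    rw [← mul_sub, abs_mul, abs_of_nonneg (by positivity : (0:ℝ) ≤ 2 ^ (S z n)), mul_comm]
  have g2 : (2:ℝ) ^ n * |B (dig z t) - B (dig z t')| = |(2:ℝ)^n * B (dig z t) - (2:ℝ)^n * B (dig z t')| := by
    rw [← mul_sub, abs_mul, abs_of_nonneg (by positivity : (0:ℝ) ≤ 2 ^ n)]
  rw [g1, g2, e1, e2]
  have c1 : |((⌊(2:ℝ)^(S z n) * t⌋ - ⌊(2:ℝ)^(S z n) * t'⌋ : ℤ) : ℝ)| ≤ |(((Xi (dig z t) n : ℤ) - Xi (dig z t') n : ℤ) : ℝ)| := by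
    rw [← Int.cast_abs, ← Int.cast_abs, Int.cast_le]
    rcases le_total 0 (⌊(2:ℝ)^(S z n) * t⌋ - ⌊(2:ℝ)^(S z n) * t'⌋) with q | q
    · have := h1 (by omega) ht ht'
      rw [abs_of_nonneg q]; exact this.trans (le_abs_self _)
    · have := h2 (by omega) ht ht'
      rw [abs_of_nonpos q]
      exact (neg_le_neg this).trans (neg_le_abs _)
  push_cast at c1
  have c2 : |(2:ℝ)^(S z n) * t - (2:ℝ)^(S z n) * t'| ≤ |((⌊(2:ℝ)^(S z n) * t⌋:ℝ) - ⌊(2:ℝ)^(S z n) * t'⌋)| + 1 := by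
    have := le_abs_self ((⌊(2:ℝ)^(S z n) * t⌋:ℝ) - ⌊(2:ℝ)^(S z n) * t'⌋)
    have := neg_le_abs ((⌊(2:ℝ)^(S z n) * t⌋:ℝ) - ⌊(2:ℝ)^(S z n) * t'⌋)
    rw [abs_le]; constructor <;> linarith
  have c3 : |((Xi (dig z t) n : ℝ) - Xi (dig z t') n)| ≤ |(Xi (dig z t) n : ℝ) + B (fun i => dig z t (n + i)) - (Xi (dig z t') n + B (fun i => dig z t' (n + i)))| + 1 := by
    have := le_abs_self ((Xi (dig z t) n : ℝ) + B (fun i => dig z t (n + i)) - (Xi (dig z t') n + B (fun i => dig z t' (n + i))))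
    have := neg_le_abs ((Xi (dig z t) n : ℝ) + B (fun i => dig z t (n + i)) - (Xi (dig z t') n + B (fun i => dig z t' (n + i))))
    rw [abs_le]; constructor <;> linarith
  linarith

lemma holder_1d (z : ℕ → Fin 2) {r : ℝ} (hr : 0 < r)
    (hS : ∀ᶠ n : ℕ in atTop, r * n ≤ S z n) :
    ∃ C : ℝ, 0 < C ∧ ∀ t ∈ Ico (0:ℝ) 1, ∀ t' ∈ Ico (0:ℝ) 1, ∀ δ : ℝ,
      |B (dig z t) - B (dig z t')| ≤ δ → |t - t'| ≤ C * δ ^ r := by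
  obtain ⟨N, hN⟩ := eventually_atTop.1 hS
  set C0 : ℝ := (2:ℝ) ^ (r * N)
  have hC0 : 1 ≤ C0 := Real.one_le_rpow (by norm_num) (by positivity)
  have hC : ∀ n : ℕ, (2:ℝ) ^ (r * n) ≤ C0 * 2 ^ (S z n) := by
    intro n
    rcases le_total N n with h | h
    · have : (2:ℝ) ^ (r * n) ≤ 2 ^ (S z n) := by
        rw [← Real.rpow_natCast 2 (S z n)]
        exact Real.rpow_le_rpow_of_exponent_le (by norm_num) (hN n h)
      nlinarith [show (0:ℝ) < 2 ^ (S z n) by positivity]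
    · have h1 : (2:ℝ) ^ (r * n) ≤ C0 := by
        apply Real.rpow_le_rpow_of_exponent_le (by norm_num)
        have : (n:ℝ) ≤ N := by exact_mod_cast h
        nlinarith
      have : (1:ℝ) ≤ 2 ^ (S z n) := one_le_pow₀ (by norm_num)
      nlinarith
  set C := 3 * C0 * 2 ^ r
  have h2r : (1:ℝ) ≤ 2 ^ r := Real.one_le_rpow (by norm_num) hr.le
  have hC1 : 1 ≤ C := by
    have : 1 ≤ C0 * 2 ^ r := by nlinarith
    have : C = 3 * (C0 * 2 ^ r) := by simp only [C]; ring
    linarith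
  refine ⟨C, by linarith, ?_⟩
  intro t ht t' ht' δ hδ
  have hδ0 : 0 ≤ δ := (abs_nonneg _).trans hδ
  have main : ∀ δ' > δ, |t - t'| ≤ C * δ' ^ r := by
    intro δ' hδ'
    have hp : 0 < δ' := by linarith
    rcases le_total 1 δ' with h1 | h1
    · have : (1:ℝ) ≤ δ' ^ r := Real.one_le_rpow h1 hr.le
      have h3 : |t - t'| ≤ 1 := by
        rw [abs_le]; constructor <;> linarith [ht.1, ht.2, ht'.1, ht'.2]
      nlinarith
    · obtain ⟨n, hn1, hn2⟩ := exists_nat_pow_near_of_lt_one hp h1 (y := (1/2:ℝ)) (by norm_num) (by norm_num)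
      have a1 := dig_ineq z ht ht' n
      have a2 : (2:ℝ) ^ n * |B (dig z t) - B (dig z t')| ≤ 1 := by
        have : |B (dig z t) - B (dig z t')| ≤ (1/2)^n := by linarith
        calc (2:ℝ) ^ n * |B (dig z t) - B (dig z t')| ≤ 2 ^ n * (1/2)^n := by gcongr
          _ = 1 := by rw [← mul_pow]; norm_num
      have a3 : |t - t'| * 2 ^ (S z n) ≤ 3 := by linarith
      have a4 : |t - t'| * 2 ^ (r * n) ≤ 3 * C0 := by
        have := hC n
        have h5 := abs_nonneg (t - t')
        nlinarith [mul_le_mul_of_nonneg_left this h5]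
      have a5 : 1 ≤ (2:ℝ) ^ (r * n) * (2 * δ') ^ r := by
        have : (2:ℝ) ^ (r * n) = ((2:ℝ)^n) ^ r := by
          rw [mul_comm, Real.rpow_mul (by norm_num), Real.rpow_natCast]
        rw [this, ← Real.mul_rpow (by positivity) (by positivity)]
        apply Real.one_le_rpow _ hr.le
        have : (1/2:ℝ)^(n+1) * (2^(n+1)) = 1 := by rw [← mul_pow]; norm_num
        rw [pow_succ 2 n] at this
        nlinarith [show (0:ℝ) < 2^n by positivity]
      rw [Real.mul_rpow (by norm_num) hp.le] at a5
      have h5 := abs_nonneg (t - t')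
      have h6 : 0 ≤ (2:ℝ)^r * δ' ^ r := by positivity
      calc |t - t'| ≤ |t - t'| * ((2:ℝ) ^ (r * n) * (2 ^ r * δ' ^ r)) := le_mul_of_one_le_right h5 a5
        _ = |t - t'| * (2:ℝ) ^ (r * n) * (2 ^ r * δ' ^ r) := by ring
        _ ≤ 3 * C0 * (2 ^ r * δ' ^ r) := by gcongr
        _ = C * δ' ^ r := by simp only [C]; ring
  have ht2 : Tendsto (fun δ' : ℝ => C * δ' ^ r) (nhdsWithin δ (Ioi δ)) (nhds (C * δ ^ r)) := by
    apply Tendsto.const_mul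
    exact ((Real.continuousAt_rpow_const δ r (Or.inr hr.le)).tendsto).mono_left nhdsWithin_le_nhds
  exact ge_of_tendsto ht2 (eventually_mem_nhdsWithin.mono (fun x hx => main x hx))

lemma dim_lower (d : ℕ) (z : ℕ → Fin 2) {s : ℝ}
    (hs : Tendsto (fun M : ℕ => (S z M : ℝ) / M) atTop (nhds s)) :
    ENNReal.ofReal (d * s) ≤ dimH (Ez d z) := by
  have key : ∀ r : NNReal, 0 < r → (r:ℝ) < s → (r : ℝ≥0∞) * d ≤ dimH (Ez d z) := by
    intro r hr hrs
    have hS : ∀ᶠ n : ℕ in atTop, (r:ℝ) * n ≤ S z n := by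
      filter_upwards [hs.eventually_const_lt hrs, eventually_gt_atTop 0] with n h1 h2
      have : (0:ℝ) < n := by exact_mod_cast h2
      rw [lt_div_iff₀ this] at h1
      exact h1.le
    obtain ⟨C, hC, hh⟩ := holder_1d z (r := r) (by exact_mod_cast hr) hS
    let T : Set (Fin d → ℝ) := Set.univ.pi (fun _ => Ico (0:ℝ) 1)
    let ψ : (Fin d → ℝ) → (Fin d → ℝ) := fun t i => B (dig z (t i))
    have hψ : ∀ t ∈ T, ∀ t' ∈ T, dist t t' ≤ C * dist (ψ t) (ψ t') ^ (r:ℝ) := by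
      intro t ht t' ht'
      rw [dist_pi_le_iff (by positivity)]
      intro i
      exact hh _ (ht i trivial) _ (ht' i trivial) _ (dist_le_pi_dist (ψ t) (ψ t') i)
    have hinj : InjOn ψ T := by
      intro t ht t' ht' h
      have := hψ t ht t' ht'
      rw [h, dist_self, Real.zero_rpow (by exact_mod_cast hr.ne'), mul_zero] at this
      exact dist_le_zero.1 this
    let finv := Function.invFunOn ψ T
    have hol : HolderOnWith C.toNNReal r finv (ψ '' T) := by
      rintro _ ⟨t, ht, rfl⟩ _ ⟨t', ht', rfl⟩
      have e1 : finv (ψ t) = t := hinj.leftInvOn_invFunOn ht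
      have e2 : finv (ψ t') = t' := hinj.leftInvOn_invFunOn ht'
      rw [e1, e2, edist_dist, edist_dist, ENNReal.ofReal_rpow_of_nonneg dist_nonneg (NNReal.coe_nonneg r)]
      have : ((C.toNNReal : NNReal) : ℝ≥0∞) = ENNReal.ofReal C := rfl
      rw [this, ← ENNReal.ofReal_mul hC.le]
      exact ENNReal.ofReal_le_ofReal (hψ t ht t' ht')
    have h1 := hol.dimH_image_le hr
    have h2 : finv '' (ψ '' T) = T := hinj.invFunOn_image subset_rfl
    rw [h2] at h1
    have h3 : (d : ℝ≥0∞) ≤ dimH T := by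
      rw [← Real.dimH_ball_pi_fin (fun _ : Fin d => (1/2:ℝ)) (r := 1/2) (by norm_num)]
      apply dimH_mono
      intro t ht i _
      have := (dist_le_pi_dist t (fun _ : Fin d => (1/2:ℝ)) i).trans_lt (Metric.mem_ball.1 ht)
      rw [Real.dist_eq, abs_lt] at this
      constructor <;> linarith [this.1, this.2]
    have h4 : dimH (ψ '' T) ≤ dimH (Ez d z) := by
      apply dimH_mono
      rintro _ ⟨t, ht, rfl⟩
      refine ⟨fun i => dig z (t i), ?_, rfl⟩
      intro i k hk
      simp [dig, hk]
    have h5 : (d : ℝ≥0∞) ≤ dimH (Ez d z) / r := (h3.trans h1).trans (ENNReal.div_le_div_right h4 _)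
    rw [mul_comm]
    exact ENNReal.mul_le_of_le_div h5
  rcases le_or_gt s 0 with h | h
  · rw [ENNReal.ofReal_of_nonpos]
    · exact zero_le
    · exact mul_nonpos_of_nonneg_of_nonpos (Nat.cast_nonneg _) h
  · have ht : Tendsto (fun r : ℝ => ENNReal.ofReal (r * d)) (nhdsWithin s (Iio s)) (nhds (ENNReal.ofReal (d * s))) := by
      rw [mul_comm]
      apply ENNReal.tendsto_ofReal
      exact (tendsto_id.mul_const _).mono_left nhdsWithin_le_nhds
    apply le_of_tendsto ht
    have : ∀ᶠ r in nhdsWithin s (Iio s), 0 < r := nhdsWithin_le_nhds (eventually_gt_nhds h)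
    filter_upwards [this, eventually_mem_nhdsWithin] with r hr1 hr2
    have := key r.toNNReal (Real.toNNReal_pos.2 hr1) (by rw [Real.coe_toNNReal r hr1.le]; exact hr2)
    rw [ENNReal.ofReal_mul hr1.le, ENNReal.ofReal_natCast]
    exact this

lemma dim_eq (d : ℕ) (z : ℕ → Fin 2) {s : ℝ}
    (hs : Tendsto (fun M : ℕ => (S z M : ℝ) / M) atTop (nhds s)) :
    dimH (Ez d z) = ENNReal.ofReal (d * s) := le_antisymm (dim_upper d z hs) (dim_lower d z hs)

end MS

namespace MS

lemma ulim (𝒰 : Ultrafilter ℕ) {X : Type*} [TopologicalSpace X] {s : Set X} (hs : IsCompact s)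
    (a : ℕ → X) (ha : ∀ᶠ j in (𝒰 : Filter ℕ), a j ∈ s) :
    ∃ x ∈ s, Tendsto a (𝒰 : Filter ℕ) (nhds x) :=
  hs.ultrafilter_le_nhds' (𝒰.map a) ha

lemma dim_aff_le (d : ℕ) (a : ℝ) (c : Fin d → ℝ) (s : Set (Fin d → ℝ)) :
    dimH ((fun x => a • x + c) '' s) ≤ dimH s := by
  have : LipschitzWith ‖a‖₊ (fun x : Fin d → ℝ => a • x + c) := by
    apply LipschitzWith.of_dist_le_mul
    intro x y
    rw [dist_add_right, dist_smul₀]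
    rfl
  exact this.dimH_image_le s

lemma dim_aff (d : ℕ) {a : ℝ} (ha : a ≠ 0) (c : Fin d → ℝ) (s : Set (Fin d → ℝ)) :
    dimH ((fun x => a • x + c) '' s) = dimH s := by
  apply le_antisymm (dim_aff_le d a c s)
  have h := dim_aff_le d a⁻¹ (-(a⁻¹ • c)) ((fun x => a • x + c) '' s)
  rw [image_image] at h
  have e : (fun x : Fin d → ℝ => a⁻¹ • (a • x + c) + -(a⁻¹ • c)) = id := by
    funext x
    rw [smul_add, smul_smul, inv_mul_cancel₀ ha, one_smul]
    simp
  rw [e, image_id] at h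
  exact h

lemma Xi_congr {w w' : ℕ → Fin 2} {n : ℕ} (h : ∀ k < n, w k = w' k) : Xi w n = Xi w' n := by
  induction n with
  | zero => rfl
  | succ n ih =>
    rw [Xi, Xi, ih (fun k hk => h k (by omega)), h n (by omega)]

lemma concat {d : ℕ} {y : ℕ → Fin 2} {n : ℕ} {w w' : Fin d → ℕ → Fin 2} (hw : w ∈ Wd d y)
    (hw' : w' ∈ Wd d (fun k => y (n + k))) :
    ∃ w'' ∈ Wd d y, (∀ i, ∀ k < n, w'' i k = w i k) ∧ ∀ i, (fun k => w'' i (n + k)) = w' i := by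
  refine ⟨fun i k => if k < n then w i k else w' i (k - n), ?_, ?_, ?_⟩
  · intro i k hk
    by_cases h : k < n
    · simp only [h, if_true]; exact hw i k hk
    · simp only [h, if_false]
      apply hw'
      show y (n + (k - n)) = 0
      rw [show n + (k - n) = k by omega]; exact hk
  · intro i k hk; simp [hk]
  · intro i; funext k; simp

/-- prefixes -/
def Hs (d : ℕ) (y : ℕ → Fin 2) (n : ℕ) (g : Fin d → ℤ) : Set (Fin d → ℤ) :=
  {h | ∃ w ∈ Wd d y, ∀ i, h i = Xi (w i) n + g i}

def Ts (d : ℕ) (z : ℕ → Fin 2) (H : Set (Fin d → ℤ)) (ρ : ℝ) (v : Fin d → ℝ) : Set (Fin d → ℝ) :=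
  {p | ∃ h ∈ H, ∃ w ∈ Wd d z, p = fun i => ρ * (h i + B (w i)) + v i}

lemma image_eq_Ts (d : ℕ) (y : ℕ → Fin 2) (n : ℕ) {lam : ℝ} (hl : 0 < lam) (u : Fin d → ℝ) :
    (fun z => lam • z + u) '' Ez d y =
      Ts d (fun k => y (n + k)) (Hs d y n (fun i => ⌊u i / (lam / 2 ^ n)⌋)) (lam / 2 ^ n)
        (fun i => (lam / 2 ^ n) * Int.fract (u i / (lam / 2 ^ n))) := by
  have hρ : 0 < lam / 2 ^ n := by positivity
  have key : ∀ (w : ℕ → Fin 2) (t : ℝ), lam * B w + t = (lam / 2 ^ n) *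
      (((Xi w n + ⌊t / (lam / 2 ^ n)⌋ : ℤ) : ℝ) + B (fun k => w (n + k))) +
        (lam / 2 ^ n) * Int.fract (t / (lam / 2 ^ n)) := by
    intro w t
    have e := B_split w n
    have e2 : lam = (lam / 2 ^ n) * 2 ^ n := by field_simp
    have e3 : t = (lam / 2 ^ n) * (t / (lam / 2 ^ n)) := by field_simp
    have e4 := Int.floor_add_fract (t / (lam / 2 ^ n))
    push_cast
    calc lam * B w + t = (lam / 2 ^ n) * (2 ^ n * B w) + (lam / 2 ^ n) * (t / (lam / 2 ^ n)) := by
          rw [← mul_assoc, ← e2, ← e3]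
      _ = (lam / 2 ^ n) * (Xi w n + B (fun i => w (n + i))) + (lam / 2 ^ n) * (⌊t / (lam / 2 ^ n)⌋ + Int.fract (t / (lam / 2 ^ n))) := by
          rw [e, e4]
      _ = _ := by ring
  ext p
  constructor
  · rintro ⟨_, ⟨w, hw, rfl⟩, rfl⟩
    refine ⟨fun i => Xi (w i) n + ⌊u i / (lam / 2 ^ n)⌋, ⟨w, hw, fun i => rfl⟩,
      fun i k => w i (n + k), fun i k hk => hw i (n + k) hk, ?_⟩
    funext i
    exact key (w i) (u i)
  · rintro ⟨h, ⟨w, hw, hh⟩, w', hw', rfl⟩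
    obtain ⟨w'', h1, h2, h3⟩ := concat hw hw'
    refine ⟨_, ⟨w'', h1, rfl⟩, ?_⟩
    funext i
    have := key (w'' i) (u i)
    rw [h3 i, Xi_congr (h2 i), ← hh i] at this
    exact this

abbrev Q (d : ℕ) : Set (Fin d → ℝ) := Set.univ.pi (fun _ => Set.Icc (0 : ℝ) 1)
abbrev Qo (d : ℕ) : Set (Fin d → ℝ) := Set.univ.pi (fun _ => Set.Ioo (0 : ℝ) 1)

lemma lim_a {d : ℕ} {𝒰 : Ultrafilter ℕ} (h𝒰 : (𝒰 : Filter ℕ) ≤ atTop) {zj : ℕ → ℕ → Fin 2} {z : ℕ → Fin 2}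
    {H : ℕ → Set (Fin d → ℤ)} {ρj : ℕ → ℝ} {vj : ℕ → Fin d → ℝ} {ρ : ℝ} {v : Fin d → ℝ} {E : Set (Fin d → ℝ)}
    (hz : ∀ k, ∀ᶠ j in (𝒰 : Filter ℕ), zj j k = z k)
    (hρj : ∀ j, ρj j ∈ Icc (1:ℝ) 2) (hvj : ∀ j i, vj j i ∈ Icc (0:ℝ) 2)
    (hρ : Tendsto ρj 𝒰 (nhds ρ)) (hv : Tendsto vj 𝒰 (nhds v))
    (hE : Tendsto (fun j => Metric.hausdorffEDist (Ts d (zj j) (H j) (ρj j) (vj j) ∩ Q d) E) 𝒰 (nhds 0))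
    {p : Fin d → ℝ} (hp : p ∈ E) :
    ∃ h : Fin d → ℤ, (∀ᶠ j in (𝒰 : Filter ℕ), h ∈ H j) ∧ ∃ w ∈ Wd d z, p = fun i => ρ * (h i + B (w i)) + v i := by
  set D := fun j => Metric.hausdorffEDist (Ts d (zj j) (H j) (ρj j) (vj j) ∩ Q d) E with hD
  have hfin : ∀ᶠ j in (𝒰 : Filter ℕ), D j < ⊤ := hE.eventually_lt_const ENNReal.zero_lt_top
  have h1 : ∀ j, ∃ h : Fin d → ℤ, ∃ w : Fin d → ℕ → Fin 2, D j < ⊤ → (h ∈ H j ∧ w ∈ Wd d (zj j) ∧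
      (fun i => ρj j * (h i + B (w i)) + vj j i) ∈ Q d ∧
      edist p (fun i => ρj j * (h i + B (w i)) + vj j i) ≤ D j + ((j:ℝ≥0∞))⁻¹) := by
    intro j
    by_cases hj : D j < ⊤
    · have : Metric.hausdorffEDist E (Ts d (zj j) (H j) (ρj j) (vj j) ∩ Q d) < D j + ((j:ℝ≥0∞))⁻¹ := by
        rw [Metric.hausdorffEDist_comm]
        exact ENNReal.lt_add_right hj.ne (by simp)
      obtain ⟨q, ⟨⟨h, hh, w, hw, rfl⟩, hq⟩, hd⟩ := Metric.exists_edist_lt_of_hausdorffEDist_lt hp this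
      exact ⟨h, w, fun _ => ⟨hh, hw, hq, hd.le⟩⟩
    · exact ⟨0, 0, fun h => absurd h hj⟩
  choose hj wj hh using h1
  have hcpt : IsCompact (Set.univ.pi (fun _ : Fin d => Icc (-4:ℤ) 4)) :=
    isCompact_univ_pi (fun _ => (Set.finite_Icc _ _).isCompact)
  obtain ⟨h, -, hlim⟩ := ulim 𝒰 hcpt hj (by
    filter_upwards [hfin] with j hjf
    obtain ⟨-, -, hq, -⟩ := hh j hjf
    intro i _
    have h3 := hq i trivial
    have r := hρj j
    have b := hvj j i
    have b1 := B_nonneg (wj j i)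
    have b2 := B_le_one (wj j i)
    have h31 := h3.1
    have h32 := h3.2
    simp only at h31 h32
    constructor
    · by_contra hc
      have : hj j i ≤ -5 := by simp at hc; omega
      have : (hj j i : ℝ) ≤ -5 := by exact_mod_cast this
      nlinarith [r.1, r.2, b.1, b.2]
    · by_contra hc
      have : 5 ≤ hj j i := by simp at hc; omega
      have : (5:ℝ) ≤ (hj j i : ℝ) := by exact_mod_cast this
      nlinarith [r.1, r.2, b.1, b.2])
  obtain ⟨w, -, wlim⟩ := ulim 𝒰 (isCompact_univ (X := Fin d → ℕ → Fin 2)) wj (by simp)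
  have hev : ∀ᶠ j in (𝒰 : Filter ℕ), hj j = h := by
    rw [tendsto_pi_nhds] at hlim
    have : ∀ i, ∀ᶠ j in (𝒰 : Filter ℕ), hj j i = h i := by
      intro i
      have := hlim i
      rw [nhds_discrete, tendsto_pure] at this
      exact this
    filter_upwards [eventually_all.2 this] with j hj'
    exact funext hj'
  refine ⟨h, ?_, w, ?_, ?_⟩
  · filter_upwards [hev, hfin] with j e1 e2
    rw [← e1]; exact (hh j e2).1
  · intro i k hk
    have := tendsto_pi_nhds.1 (tendsto_pi_nhds.1 wlim i) k
    rw [nhds_discrete, tendsto_pure] at this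
    have h3 : ∀ᶠ j in (𝒰 : Filter ℕ), w i k = 0 := by
      filter_upwards [this, hz k, hfin] with j e1 e2 e3
      rw [← e1]
      exact (hh j e3).2.1 i k (by rw [e2, hk])
    exact h3.exists.choose_spec
  · have t1 : Tendsto (fun j => (fun i => ρj j * (hj j i + B (wj j i)) + vj j i : Fin d → ℝ)) 𝒰
        (nhds (fun i => ρ * (h i + B (w i)) + v i)) := by
      rw [tendsto_pi_nhds]
      intro i
      apply Tendsto.add _ (tendsto_pi_nhds.1 hv i)
      apply Tendsto.mul hρ
      apply Tendsto.add
      · exact tendsto_const_nhds.congr' (hev.mono (fun j e => by simp only [e]))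
      · exact (B_cont.tendsto _).comp (tendsto_pi_nhds.1 wlim i)
    have t2 : Tendsto (fun j => (fun i => ρj j * (hj j i + B (wj j i)) + vj j i : Fin d → ℝ)) 𝒰
        (nhds p) := by
      rw [tendsto_iff_edist_tendsto_0]
      have t3 : Tendsto (fun j : ℕ => D j + ((j:ℝ≥0∞))⁻¹) 𝒰 (nhds 0) := by
        have := hE.add (ENNReal.tendsto_inv_nat_nhds_zero.mono_left h𝒰)
        simpa using this
      refine tendsto_of_tendsto_of_tendsto_of_le_of_le' tendsto_const_nhds t3 (Eventually.of_forall fun _ => zero_le) ?_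
      filter_upwards [hfin] with j hjf
      rw [edist_comm]
      exact (hh j hjf).2.2.2
    exact tendsto_nhds_unique t2 t1

lemma lim_b {d : ℕ} {𝒰 : Ultrafilter ℕ} {zj : ℕ → ℕ → Fin 2} {z : ℕ → Fin 2}
    {H : ℕ → Set (Fin d → ℤ)} {ρj : ℕ → ℝ} {vj : ℕ → Fin d → ℝ} {ρ : ℝ} {v : Fin d → ℝ} {E : Set (Fin d → ℝ)}
    (hEc : IsClosed E)
    (hz : ∀ k, ∀ᶠ j in (𝒰 : Filter ℕ), zj j k = z k)
    (hρ : Tendsto ρj 𝒰 (nhds ρ)) (hv : Tendsto vj 𝒰 (nhds v))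
    (hE : Tendsto (fun j => Metric.hausdorffEDist (Ts d (zj j) (H j) (ρj j) (vj j) ∩ Q d) E) 𝒰 (nhds 0))
    {h : Fin d → ℤ} (hh : ∀ᶠ j in (𝒰 : Filter ℕ), h ∈ H j) {w : Fin d → ℕ → Fin 2} (hw : w ∈ Wd d z)
    (hp : (fun i => ρ * (h i + B (w i)) + v i) ∈ Qo d) :
    (fun i => ρ * (h i + B (w i)) + v i) ∈ E := by
  let wj : ℕ → Fin d → ℕ → Fin 2 := fun j i k => if zj j k = 0 then 0 else w i k
  have hwj : ∀ j, wj j ∈ Wd d (zj j) := by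
    intro j i k hk
    simp [wj, hk]
  have wlim : Tendsto wj 𝒰 (nhds w) := by
    rw [tendsto_pi_nhds]; intro i
    rw [tendsto_pi_nhds]; intro k
    rw [nhds_discrete, tendsto_pure]
    filter_upwards [hz k] with j e
    by_cases h0 : z k = 0
    · simp [wj, e, h0, hw i k h0]
    · simp [wj, e, h0]
  have t1 : Tendsto (fun j => (fun i => ρj j * (h i + B (wj j i)) + vj j i : Fin d → ℝ)) 𝒰
      (nhds (fun i => ρ * (h i + B (w i)) + v i)) := by
    rw [tendsto_pi_nhds]
    intro i
    apply Tendsto.add _ (tendsto_pi_nhds.1 hv i)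
    apply Tendsto.mul hρ
    apply Tendsto.add tendsto_const_nhds
    exact (B_cont.tendsto _).comp (tendsto_pi_nhds.1 wlim i)
  have hop : IsOpen (Qo d) := isOpen_set_pi finite_univ (fun _ _ => isOpen_Ioo)
  have hev := t1.eventually (hop.mem_nhds hp)
  rw [Metric.mem_iff_infEDist_zero_of_closed hEc]
  have t2 := (Metric.continuous_infEDist (s := E)).tendsto _ |>.comp t1
  have t3 : Tendsto (fun j => Metric.infEDist (fun i => ρj j * (h i + B (wj j i)) + vj j i : Fin d → ℝ) E) 𝒰 (nhds 0) := by
    refine tendsto_of_tendsto_of_tendsto_of_le_of_le' tendsto_const_nhds hE (Eventually.of_forall fun _ => zero_le) ?_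
    filter_upwards [hev, hh] with j e1 e2
    apply Metric.infEDist_le_hausdorffEDist_of_mem
    refine ⟨⟨h, e2, wj j, hwj j, rfl⟩, ?_⟩
    intro i hi
    exact Ioo_subset_Icc_self (e1 i hi)
  exact tendsto_nhds_unique t2 t3

lemma shift_lim {z : ℕ → Fin 2} {s : ℝ} (m : ℕ)
    (hs : Tendsto (fun M : ℕ => (S z M : ℝ) / M) atTop (nhds s)) :
    Tendsto (fun M : ℕ => (S (fun k => z (m + k)) M : ℝ) / M) atTop (nhds s) := by
  have h1 : Tendsto (fun M : ℕ => (S z (M + m) : ℝ) / (M + m : ℕ)) atTop (nhds s) :=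
    hs.comp (tendsto_add_atTop_nat m)
  have h2 : Tendsto (fun M : ℕ => (1 + (m:ℝ) / M)) atTop (nhds 1) := by
    simpa using (tendsto_const_div_atTop_nhds_zero_nat (m:ℝ)).const_add 1
  have h3 : Tendsto (fun M : ℕ => ((S z m:ℝ) / M)) atTop (nhds 0) :=
    tendsto_const_div_atTop_nhds_zero_nat _
  have h4 := (h1.mul h2).sub h3
  rw [mul_one, sub_zero] at h4
  refine h4.congr' ?_
  filter_upwards [eventually_gt_atTop 0] with M hM
  rw [add_comm M m, S_add]
  have : (0:ℝ) < M := by exact_mod_cast hM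
  push_cast
  field_simp
  ring

lemma micro_abs {d : ℕ} {𝒰 : Ultrafilter ℕ} (h𝒰 : (𝒰 : Filter ℕ) ≤ atTop) {zj : ℕ → ℕ → Fin 2} {z : ℕ → Fin 2}
    {H : ℕ → Set (Fin d → ℤ)} {ρj : ℕ → ℝ} {vj : ℕ → Fin d → ℝ} {E : Set (Fin d → ℝ)}
    (hEc : IsClosed E) (hne : (E ∩ Qo d).Nonempty)
    (hz : ∀ k, ∀ᶠ j in (𝒰 : Filter ℕ), zj j k = z k)
    (hρj : ∀ j, ρj j ∈ Icc (1:ℝ) 2) (hvj : ∀ j i, vj j i ∈ Icc (0:ℝ) 2)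
    (hE : Tendsto (fun j => Metric.hausdorffEDist (Ts d (zj j) (H j) (ρj j) (vj j) ∩ Q d) E) 𝒰 (nhds 0))
    {s : ℝ} (hs : Tendsto (fun M : ℕ => (S z M : ℝ) / M) atTop (nhds s)) :
    dimH E = ENNReal.ofReal (d * s) := by
  obtain ⟨ρ, hρ1, hρ⟩ := ulim 𝒰 (isCompact_Icc (a := (1:ℝ)) (b := 2)) ρj (Eventually.of_forall hρj)
  obtain ⟨v, -, hv⟩ := ulim 𝒰 (isCompact_univ_pi (fun _ : Fin d => isCompact_Icc (a := (0:ℝ)) (b := 2))) vj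
    (Eventually.of_forall (fun j i _ => hvj j i))
  apply le_antisymm
  · have hsub : E ⊆ ⋃ h : Fin d → ℤ, (fun x => ρ • x + ((fun i => ρ * h i + v i) : Fin d → ℝ)) '' Ez d z := by
      intro p hp
      obtain ⟨h, -, w, hw, rfl⟩ := lim_a h𝒰 hz hρj hvj hρ hv hE hp
      rw [mem_iUnion]
      refine ⟨h, _, ⟨w, hw, rfl⟩, ?_⟩
      funext i
      simp; ring
    refine (dimH_mono hsub).trans ?_
    rw [dimH_iUnion]
    apply iSup_le
    intro h
    exact (dim_aff_le d _ _ _).trans (dim_eq d z hs).le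
  · obtain ⟨p, hpE, hpQ⟩ := hne
    obtain ⟨h, hh, w, hw, rfl⟩ := lim_a h𝒰 hz hρj hvj hρ hv hE hpE
    have hop : IsOpen (Qo d) := isOpen_set_pi finite_univ (fun _ _ => isOpen_Ioo)
    obtain ⟨ε, hε, hball⟩ := Metric.isOpen_iff.1 hop _ hpQ
    obtain ⟨m, hm⟩ := exists_pow_lt_of_lt_one (show 0 < ε / 2 by positivity) (show (1/2:ℝ) < 1 by norm_num)
    have hρ0 : 0 < ρ := by linarith [hρ1.1]
    have hsub : (fun x => (ρ / 2 ^ m) • x + ((fun i => ρ * (h i + Xi (w i) m / 2 ^ m) + v i) : Fin d → ℝ)) '' Ez d (fun k => z (m + k)) ⊆ E := by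
      rintro _ ⟨_, ⟨w', hw', rfl⟩, rfl⟩
      obtain ⟨w'', h1, h2, h3⟩ := concat hw hw'
      have e : (fun x => (ρ / 2 ^ m) • x + ((fun i => ρ * (h i + Xi (w i) m / 2 ^ m) + v i) : Fin d → ℝ)) (fun i => B (w' i))
          = fun i => ρ * (h i + B (w'' i)) + v i := by
        funext i
        have := B_split (w'' i) m
        rw [h3 i, Xi_congr (h2 i)] at this
        have e2 : B (w'' i) = (Xi (w i) m + B (w' i)) / 2 ^ m := by
          rw [← this]; field_simp
        rw [e2]
        simp
        field_simp
        ring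
      rw [e]
      apply lim_b hEc hz hρ hv hE hh h1
      apply hball
      rw [Metric.mem_ball, dist_pi_lt_iff hε]
      intro i
      have b := B_agree (h2 i)
      have : ρ * (h i + B (w'' i)) + v i - (ρ * (h i + B (w i)) + v i) = ρ * (B (w'' i) - B (w i)) := by ring
      rw [Real.dist_eq, this, abs_mul, abs_of_pos hρ0]
      have e3 : (1/2:ℝ)^m = ((2:ℝ)^m)⁻¹ := by simp
      rw [e3] at hm
      nlinarith [hρ1.2, abs_nonneg (B (w'' i) - B (w i))]
    refine le_trans ?_ (dimH_mono hsub)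
    rw [dim_aff d (by positivity), dim_eq d _ (shift_lim m hs)]

lemma micro {d : ℕ} {𝒰 : Ultrafilter ℕ} (h𝒰 : (𝒰 : Filter ℕ) ≤ atTop) {y z : ℕ → Fin 2} {n : ℕ → ℕ}
    {lam : ℕ → ℝ} {u : ℕ → Fin d → ℝ} {E : Set (Fin d → ℝ)}
    (hEc : IsClosed E) (hne : (E ∩ Qo d).Nonempty)
    (hz : ∀ k, ∀ᶠ j in (𝒰 : Filter ℕ), y (n j + k) = z k)
    (hn : ∀ j, 2 ^ (n j) ≤ lam j ∧ lam j < 2 ^ (n j + 1))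
    (hE : Tendsto (fun j => Metric.hausdorffEDist (((fun x => lam j • x + u j) '' Ez d y) ∩ Q d) E) atTop (nhds 0))
    {s : ℝ} (hs : Tendsto (fun M : ℕ => (S z M : ℝ) / M) atTop (nhds s)) :
    dimH E = ENNReal.ofReal (d * s) := by
  have hl : ∀ j, 0 < lam j := fun j => lt_of_lt_of_le (by positivity) (hn j).1
  have hr : ∀ j, lam j / 2 ^ (n j) ∈ Icc (1:ℝ) 2 := by
    intro j
    constructor
    · rw [le_div_iff₀ (by positivity), one_mul]; exact (hn j).1
    · rw [div_le_iff₀ (by positivity), ← pow_succ']; exact (hn j).2.le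
  refine micro_abs h𝒰 (zj := fun j k => y (n j + k)) (z := z)
    (H := fun j => Hs d y (n j) (fun i => ⌊u j i / (lam j / 2 ^ (n j))⌋)) (ρj := fun j => lam j / 2 ^ (n j))
    (vj := fun j i => (lam j / 2 ^ (n j)) * Int.fract (u j i / (lam j / 2 ^ (n j)))) hEc hne hz hr ?_ ?_ hs
  · intro j i
    have := hr j
    have f1 := Int.fract_nonneg (u j i / (lam j / 2 ^ (n j)))
    have f2 := (Int.fract_lt_one (u j i / (lam j / 2 ^ (n j)))).le
    constructor
    · exact mul_nonneg (by linarith [this.1]) f1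
    · nlinarith [this.1, this.2]
  · have : Tendsto (fun j => Metric.hausdorffEDist (((fun x => lam j • x + u j) '' Ez d y) ∩ Q d) E) 𝒰 (nhds 0) := hE.mono_left h𝒰
    refine this.congr fun j => ?_
    rw [image_eq_Ts d y (n j) (hl j)]

lemma Ez_compact (d : ℕ) (z : ℕ → Fin 2) : IsCompact (Ez d z) := by
  apply IsCompact.image
  · apply IsClosed.isCompact
    have : Wd d z = ⋂ i, ⋂ k, {w | z k = 0 → w i k = 0} := by
      ext w; simp [Wd]
    rw [this]
    refine isClosed_iInter fun i => isClosed_iInter fun k => ?_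
    by_cases h : z k = 0
    · simp only [h, true_imp_iff]
      exact isClosed_eq ((continuous_apply k).comp (continuous_apply i)) continuous_const
    · simp [h]
  · exact continuous_pi fun i => B_cont.comp (continuous_apply i)

lemma exists_z (𝒰 : Ultrafilter ℕ) (y : ℕ → Fin 2) (n : ℕ → ℕ) :
    ∃ z : ℕ → Fin 2, ∀ k, ∀ᶠ j in (𝒰 : Filter ℕ), y (n j + k) = z k := by
  obtain ⟨z, -, h⟩ := ulim 𝒰 (isCompact_univ (X := ℕ → Fin 2)) (fun j k => y (n j + k)) (by simp)
  refine ⟨z, fun k => ?_⟩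
  have := tendsto_pi_nhds.1 h k
  rw [nhds_discrete, tendsto_pure] at this
  exact this

end MS

namespace MS

lemma param (d : ℕ) (hd : 1 ≤ d) (A : Set ℝ) (hne : A.Nonempty)
    (hsub : A ⊆ Set.Icc 0 (d : ℝ)) (han : MeasureTheory.AnalyticSet A)
    (hinf : sInf A ∈ A) (hsup : sSup A ∈ A) :
    ∃ (f : (ℕ → ℕ) → ℝ) (α β : ℝ), Continuous f ∧ (∀ c, f c ∈ Icc (0:ℝ) 1) ∧
      ((∃ c, f c = 0) ∧ (∃ c, f c = 1)) ∧ 0 ≤ α ∧ α ≤ β ∧ β ≤ 1 ∧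
      range (fun c => d * (α + (β - α) * f c)) = A := by
  have hd0 : (0:ℝ) < d := by exact_mod_cast hd
  have hle : ∀ a ∈ A, sInf A ≤ a := fun a ha => csInf_le ⟨0, fun x hx => (hsub hx).1⟩ ha
  have hge : ∀ a ∈ A, a ≤ sSup A := fun a ha => le_csSup ⟨d, fun x hx => (hsub hx).2⟩ ha
  have ha0 : 0 ≤ sInf A / d := div_nonneg (hsub hinf).1 hd0.le
  have hb1 : sSup A / d ≤ 1 := by rw [div_le_one hd0]; exact (hsub hsup).2
  rcases (hle _ hsup).eq_or_lt with h | h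
  · have hA : A = {sInf A} := by
      apply Subset.antisymm
      · intro a ha
        exact le_antisymm (by rw [h]; exact hge a ha) (hle a ha)
      · intro a ha; rw [mem_singleton_iff.1 ha]; exact hinf
    refine ⟨fun c => ((min (c 0) 1 : ℕ) : ℝ), sInf A / d, sInf A / d, ?_, ?_, ⟨⟨fun _ => 0, by simp⟩, ⟨fun _ => 1, by simp⟩⟩,
      ha0, le_rfl, by rw [h]; exact hb1, ?_⟩
    · exact (continuous_of_discreteTopology (f := fun k : ℕ => ((min k 1 : ℕ) : ℝ))).comp (continuous_apply 0)
    · intro c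
      refine ⟨by positivity, ?_⟩
      have : min (c 0) 1 ≤ 1 := min_le_right _ _
      show ((min (c 0) 1 : ℕ) : ℝ) ≤ 1
      exact_mod_cast this
    · have e : (fun c : ℕ → ℕ => (d:ℝ) * (sInf A / d + (sInf A / d - sInf A / d) * ((min (c 0) 1 : ℕ) : ℝ))) = fun _ => sInf A := by
        funext c; rw [sub_self, zero_mul, add_zero]; field_simp
      rw [e, range_const]; exact hA.symm
  · rw [AnalyticSet] at han
    rcases han with han | ⟨F, hF, hr⟩
    · exact absurd han hne.ne_empty
    have hFA : ∀ c, F c ∈ A := fun c => by rw [← hr]; exact mem_range_self c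
    have hpos : 0 < sSup A - sInf A := by linarith
    refine ⟨fun c => (F c - sInf A) / (sSup A - sInf A), sInf A / d, sSup A / d, by fun_prop, ?_, ⟨?_, ?_⟩,
      ha0, ?_, hb1, ?_⟩
    · intro c
      constructor
      · exact div_nonneg (by linarith [hle _ (hFA c)]) hpos.le
      · rw [div_le_one hpos]; linarith [hge _ (hFA c)]
    · rw [← hr] at hinf
      obtain ⟨c, hc⟩ := hinf
      exact ⟨c, by simp only; rw [hc, hr]; simp⟩
    · rw [← hr] at hsup
      obtain ⟨c, hc⟩ := hsup
      exact ⟨c, by simp only; rw [hc, hr]; exact div_self hpos.ne'⟩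
    · gcongr
    · have e : (fun c : ℕ → ℕ => (d:ℝ) * (sInf A / d + (sSup A / d - sInf A / d) * ((F c - sInf A) / (sSup A - sInf A)))) = F := by
        funext c
        field_simp
        ring
      rw [e, hr]

open TopologicalSpace in
lemma subseq (d : ℕ) (T : ℕ → Set (Fin d → ℝ)) (hT : ∀ j, IsClosed (T j)) (p : Fin d → ℝ) (hp : ∀ j, p ∈ T j)
    (hpQ : p ∈ Q d) :
    ∃ E : Set (Fin d → ℝ), IsCompact E ∧ E ⊆ Q d ∧ p ∈ E ∧ ∃ φ : ℕ → ℕ, StrictMono φ ∧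
      Tendsto (fun j => Metric.hausdorffEDist (T (φ j) ∩ Q d) E) atTop (nhds 0) := by
  have hQ : IsCompact (Q d) := isCompact_univ_pi (fun _ => isCompact_Icc)
  have : CompactSpace (Q d) := isCompact_iff_compactSpace.1 hQ
  let C : ℕ → Closeds (Q d) := fun j => ⟨Subtype.val ⁻¹' (T j), (hT j).preimage continuous_subtype_val⟩
  obtain ⟨E, φ, hφ, hlim⟩ := CompactSpace.tendsto_subseq C
  rw [tendsto_iff_edist_tendsto_0] at hlim
  have key : ∀ j, edist (C (φ j)) E = Metric.hausdorffEDist (T (φ j) ∩ Q d) (Subtype.val '' (E : Set (Q d))) := by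
    intro j
    rw [Closeds.edist_eq, ← Metric.hausdorffEDist_image (isometry_subtype_coe (s := Q d))]
    congr 1
    show Subtype.val '' (Subtype.val ⁻¹' (T (φ j))) = _
    rw [Subtype.image_preimage_coe, inter_comm]
  have hEc : IsCompact (Subtype.val '' (E : Set (Q d))) := E.isClosed.isCompact.image continuous_subtype_val
  have hlim' : Tendsto (fun j => Metric.hausdorffEDist (T (φ j) ∩ Q d) (Subtype.val '' (E : Set (Q d)))) atTop (nhds 0) := by
    simpa only [Function.comp, key] using hlim
  refine ⟨Subtype.val '' (E : Set (Q d)), hEc, Subtype.coe_image_subset _ _, ?_, φ, hφ, hlim'⟩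
  rw [Metric.mem_iff_infEDist_zero_of_closed hEc.isClosed]
  refine le_antisymm (ge_of_tendsto' hlim' fun j => ?_) zero_le
  exact Metric.infEDist_le_hausdorffEDist_of_mem ⟨hp _, hpQ⟩

end MS

/-- If `A ⊆ [0,d]` is a nonempty analytic set containing its infimum and supremum, then
there is a compact set `K ⊆ ℝ^d` whose microsets attain exactly the Hausdorff dimensions
in `A`. -/
theorem statement0 (d : ℕ) (hd : 1 ≤ d) (A : Set ℝ) (hne : A.Nonempty)
    (hsub : A ⊆ Set.Icc 0 (d : ℝ)) (han : MeasureTheory.AnalyticSet A)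
    (hinf : sInf A ∈ A) (hsup : sSup A ∈ A) :
    ∃ K : Set (Fin d → ℝ), IsCompact K ∧
      {e : ℝ≥0∞ | ∃ E, IsMicroset d K E ∧ dimH E = e} = ENNReal.ofReal '' A := by
  obtain ⟨f, α, β, hf, h01, hex, h0, h1, h2, hA⟩ := MS.param d hd A hne hsub han hinf hsup
  obtain ⟨y, hy1, hy2⟩ := MS.comb hf h01 hex h0 h1 h2
  have h𝒰 : ((hyperfilter ℕ : Ultrafilter ℕ) : Filter ℕ) ≤ atTop := by
    rw [← Nat.cofinite_eq_atTop]; exact hyperfilter_le_cofinite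
  refine ⟨MS.Ez d y, MS.Ez_compact d y, ?_⟩
  ext e
  constructor
  · rintro ⟨E, ⟨hEc, hEQ, hEne, lam, u, hlam, hlim⟩, rfl⟩
    have hn : ∀ j, ∃ n : ℕ, (2:ℝ) ^ n ≤ lam j ∧ lam j < 2 ^ (n + 1) := fun j =>
      exists_nat_pow_near (hlam j) (by norm_num)
    choose n hn using hn
    obtain ⟨z, hz⟩ := MS.exists_z (hyperfilter ℕ) y n
    obtain ⟨c, hc⟩ := hy1 _ n z hz
    have := MS.micro h𝒰 hEc.isClosed hEne hz hn hlim hc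
    refine ⟨_, ?_, this.symm⟩
    rw [← hA]
    exact ⟨c, rfl⟩
  · rintro ⟨a, ha, rfl⟩
    rw [← hA] at ha
    obtain ⟨c, rfl⟩ := ha
    obtain ⟨n, hn⟩ := hy2 c
    let p : Fin d → ℝ := fun _ => 1/2
    have hp : ∀ j, p ∈ (fun x => ((2:ℝ) ^ (n j)) • x + p) '' MS.Ez d y := by
      intro j
      refine ⟨0, ⟨fun _ _ => 0, fun _ _ _ => rfl, ?_⟩, by simp⟩
      funext i
      simp [MS.B, Real.ofDigits, Real.ofDigitsTerm]
    obtain ⟨E, hEc, hEQ, hpE, φ, hφ, hlim⟩ := MS.subseq d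
      (fun j => (fun x => ((2:ℝ) ^ (n j)) • x + p) '' MS.Ez d y)
      (fun j => ((MS.Ez_compact d y).image (by fun_prop)).isClosed) p hp
      (fun i _ => ⟨by norm_num [p], by norm_num [p]⟩)
    have hEne : (E ∩ MS.Qo d).Nonempty := ⟨p, hpE, fun i _ => ⟨by norm_num [p], by norm_num [p]⟩⟩
    refine ⟨E, ⟨hEc, hEQ, hEne, fun j => (2:ℝ) ^ (n (φ j)), fun _ => p, fun j => one_le_pow₀ (by norm_num), hlim⟩, ?_⟩
    obtain ⟨z, hz⟩ := MS.exists_z (hyperfilter ℕ) y (fun j => n (φ j))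
    have hs := hn φ hφ (hyperfilter ℕ) h𝒰 z hz
    exact MS.micro h𝒰 (n := fun j => n (φ j)) (lam := fun j => (2:ℝ) ^ (n (φ j))) (u := fun _ => p) hEc.isClosed hEne hz
      (fun j => ⟨le_rfl, pow_lt_pow_right₀ (by norm_num) (by omega)⟩) hlim hs
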